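/- Let n ≥ 1, let Ω be an open set in ℝⁿ, let a ≥ 0, and let q > p ≥ 1. For a compact set K ⊂ Ω define the (p,a)-capacity cap_{p,a}(K, Ω) = inf{ ∫_Ω |∇v(x)|^p |x|^{−a} dx : v ∈ C_0^∞(Ω), v ≥ 1 on K }. Then for every u ∈ C_0^∞(Ω), with M_t = {x ∈ Ω : |u(x)| ≥ t}, the capacitary inequality ( q · ∫_0^∞ t^{q−1} ( cap_{p,a}(M_t, Ω) )^{q/p} dt )^{1/q} ≤ A_{p,q} · ( ∫_Ω |∇u(x)|^p |x|^{−a} dx )^{1/p} holds, where A_{p,q} = ( Γ(pq/(q−p)) / ( Γ(q/(q−p)) · Γ(p(q−1)/(q−p)) ) )^{1/p − 1/q}. -/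

import Mathlib

open MeasureTheory
open scoped Real

noncomputable section

/-- The `(p,a)`-capacity of a set `K` relative to an open set `Ω ⊆ ℝⁿ`:
`cap_{p,a}(K, Ω) = inf { ∫_Ω |∇v|^p |x|^{−a} dx : v ∈ C_0^∞(Ω), v ≥ 1 on K }`. -/
def capPA {n : ℕ} (p a : ℝ) (K Ω : Set (EuclideanSpace ℝ (Fin n))) : ℝ :=
  sInf { r : ℝ | ∃ v : EuclideanSpace ℝ (Fin n) → ℝ, ContDiff ℝ (⊤ : ℕ∞) v ∧
    HasCompactSupport v ∧ tsupport v ⊆ Ω ∧ (∀ x ∈ K, 1 ≤ v x) ∧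
    r = ∫ x in Ω, ‖fderiv ℝ v x‖ ^ p * ‖x‖ ^ (-a) }

/-- Young's inequality along a path. -/
lemma young_path {p q t x f z w : ℝ} (hp : 1 < p)
    (ht : 0 < t) (hx : 0 < x) (hf : 0 < f) (hz : 0 < z) (hw : 0 < w) :
    t ^ (q * ((p - 1) / p)) * x ^ (-((q * ((p - 1) / p) + 1) * ((p - 1) / p))) *
        (z / w) ^ ((p - 1) / p) ≤
      1 / p * f ^ (1 - p) +
        (p - 1) / p * (z / w * (t ^ q * x ^ (-(q * ((p - 1) / p) + 1)) * f)) := by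
  have hp0 : 0 < p := by linarith
  have key := Real.geom_mean_le_arith_mean2_weighted (w₁ := 1 / p) (w₂ := (p - 1) / p)
    (p₁ := f ^ (1 - p)) (p₂ := z / w * (t ^ q * x ^ (-(q * ((p - 1) / p) + 1)) * f))
    (by positivity) (div_nonneg (by linarith) hp0.le) (by positivity) (by positivity)
    (by field_simp; ring)
  refine le_trans (le_of_eq ?_) key
  obtain ⟨t, rfl⟩ : ∃ s, t = Real.exp s := ⟨_, (Real.exp_log ht).symm⟩
  obtain ⟨x, rfl⟩ : ∃ s, x = Real.exp s := ⟨_, (Real.exp_log hx).symm⟩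
  obtain ⟨f, rfl⟩ : ∃ s, f = Real.exp s := ⟨_, (Real.exp_log hf).symm⟩
  obtain ⟨z, rfl⟩ : ∃ s, z = Real.exp s := ⟨_, (Real.exp_log hz).symm⟩
  obtain ⟨w, rfl⟩ : ∃ s, w = Real.exp s := ⟨_, (Real.exp_log hw).symm⟩
  simp only [← Real.exp_sub, ← Real.exp_mul, ← Real.exp_add]
  congr 1
  field_simp
  ring

/-- The arithmetic-geometric mean inequality for the transport map. -/
lemma amgm_path {p q t x f z w : ℝ} (hp : 1 < p) (hpq : p < q)
    (ht : 0 < t) (hx : 0 < x) (hf : 0 < f) (hz : 0 < z) (hw : 0 < w) :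
    t ^ q * x ^ (-(q * ((p - 1) / p) + 1)) * f / w ≤
    t ^ (q * ((p - 1) / p) + 1) * x ^ (-((q * ((p - 1) / p) + 1) * ((p - 1) / p))) *
        (z / w) ^ ((p - 1) / p) *
      ((q * ((p - 1) / p) + 1) / q * (f / x) + (q - p) / (p * q) *
        (t ^ q * x ^ (-(q * ((p - 1) / p) + 1)) * f * z ^ (-(q * (p - 1) / (q - p))) *
          w ^ (-(q / (q - p))))) := by
  have hp0 : 0 < p := by linarith
  have hq0 : 0 < q := by linarith
  have hqp : 0 < q - p := by linarith
  have key := Real.geom_mean_le_arith_mean2_weighted (w₁ := (q * ((p - 1) / p) + 1) / q)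
    (w₂ := (q - p) / (p * q)) (p₁ := f / x)
    (p₂ := t ^ q * x ^ (-(q * ((p - 1) / p) + 1)) * f * z ^ (-(q * (p - 1) / (q - p))) *
          w ^ (-(q / (q - p))))
    (by have : 0 ≤ p - 1 := by linarith
        positivity) (by positivity) (by positivity) (by positivity)
    (by field_simp; ring)
  refine le_trans (le_of_eq ?_) (mul_le_mul_of_nonneg_left key (by positivity))
  obtain ⟨t, rfl⟩ : ∃ s, t = Real.exp s := ⟨_, (Real.exp_log ht).symm⟩
  obtain ⟨x, rfl⟩ : ∃ s, x = Real.exp s := ⟨_, (Real.exp_log hx).symm⟩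
  obtain ⟨f, rfl⟩ : ∃ s, f = Real.exp s := ⟨_, (Real.exp_log hf).symm⟩
  obtain ⟨z, rfl⟩ : ∃ s, z = Real.exp s := ⟨_, (Real.exp_log hz).symm⟩
  obtain ⟨w, rfl⟩ : ∃ s, w = Real.exp s := ⟨_, (Real.exp_log hw).symm⟩
  simp only [← Real.exp_sub, ← Real.exp_mul, ← Real.exp_add]
  congr 1
  field_simp
  ring

lemma exists_inverse {f f' : ℝ → ℝ} (hc : ContinuousOn f (Set.Icc 0 1))
    (hd : ∀ x ∈ Set.Ioo (0 : ℝ) 1, HasDerivAt f (f' x) x) (hpos : ∀ x ∈ Set.Ioo (0 : ℝ) 1, 0 < f' x)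
    (h0 : f 0 = 0) :
    StrictMonoOn f (Set.Icc 0 1) ∧ ∃ g : ℝ → ℝ, ContinuousOn g (Set.Icc 0 (f 1)) ∧
      (∀ y ∈ Set.Icc 0 (f 1), g y ∈ Set.Icc (0 : ℝ) 1) ∧ (∀ y ∈ Set.Icc 0 (f 1), f (g y) = y) ∧
      (∀ x ∈ Set.Icc (0 : ℝ) 1, g (f x) = x) ∧
      (∀ y ∈ Set.Ioo 0 (f 1), g y ∈ Set.Ioo (0 : ℝ) 1) ∧
      ∀ y ∈ Set.Ioo 0 (f 1), HasDerivAt g (f' (g y))⁻¹ y := by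
  have hmono : StrictMonoOn f (Set.Icc 0 1) := by
    refine strictMonoOn_of_deriv_pos (convex_Icc 0 1) hc fun x hx => ?_
    rw [interior_Icc] at hx
    rw [(hd x hx).deriv]; exact hpos x hx
  have himg : f '' Set.Icc 0 1 = Set.Icc 0 (f 1) := by
    refine le_antisymm ?_ ?_
    · rintro _ ⟨x, hx, rfl⟩
      refine ⟨h0 ▸ hmono.monotoneOn (by simp) hx hx.1, hmono.monotoneOn hx (by simp) hx.2⟩
    · have := intermediate_value_Icc (zero_le_one' ℝ) hc
      rwa [h0] at this
  set g := Function.invFunOn f (Set.Icc 0 1) with hg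
  have hmem : ∀ y ∈ Set.Icc 0 (f 1), g y ∈ Set.Icc (0 : ℝ) 1 := fun y hy =>
    Function.invFunOn_mem (by rw [← himg] at hy; exact hy)
  have hfg : ∀ y ∈ Set.Icc 0 (f 1), f (g y) = y := fun y hy =>
    Function.invFunOn_eq (by rw [← himg] at hy; exact hy)
  have hgf : ∀ x ∈ Set.Icc (0 : ℝ) 1, g (f x) = x := fun x hx =>
    hmono.injOn.leftInvOn_invFunOn hx
  have hgc : ContinuousOn g (Set.Icc 0 (f 1)) := by
    rw [continuousOn_iff_isClosed]
    intro C hC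
    refine ⟨f '' (C ∩ Set.Icc 0 1), ?_, ?_⟩
    · exact ((isCompact_Icc.inter_left hC).image_of_continuousOn
        (hc.mono Set.inter_subset_right)).isClosed
    · ext y
      constructor
      · rintro ⟨hy, hy'⟩
        exact ⟨⟨g y, ⟨hy, hmem y hy'⟩, hfg y hy'⟩, hy'⟩
      · rintro ⟨⟨x, ⟨hx, hx'⟩, rfl⟩, hy'⟩
        refine ⟨?_, hy'⟩
        rw [Set.mem_preimage, hgf x hx']
        exact hx
  have hIoo : ∀ y ∈ Set.Ioo 0 (f 1), g y ∈ Set.Ioo (0 : ℝ) 1 := by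
    intro y hy
    have h1 := hmem y ⟨hy.1.le, hy.2.le⟩
    have h2 := hfg y ⟨hy.1.le, hy.2.le⟩
    refine ⟨lt_of_le_of_ne h1.1 ?_, lt_of_le_of_ne h1.2 ?_⟩
    · intro h; rw [← h, h0] at h2; exact hy.1.ne h2
    · intro h; rw [h] at h2; exact hy.2.ne' h2
  refine ⟨hmono, g, hgc, hmem, hfg, hgf, hIoo, fun y hy => ?_⟩
  refine HasDerivAt.of_local_left_inverse
    (hgc.continuousAt (Icc_mem_nhds hy.1 hy.2)) (hd _ (hIoo y hy)) (hpos _ (hIoo y hy)).ne' ?_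
  filter_upwards [Icc_mem_nhds hy.1 hy.2] with x hx using hfg x hx

lemma sub_le_sub_of_right_deriv_le {f f' g g' : ℝ → ℝ} {a b : ℝ} (hab : a < b)
    (hf : ContinuousOn f (Set.Icc a b)) (hg : ContinuousOn g (Set.Icc a b))
    (hf' : ∀ x ∈ Set.Ioo a b, HasDerivWithinAt f (f' x) (Set.Ici x) x)
    (hg' : ∀ x ∈ Set.Ioo a b, HasDerivWithinAt g (g' x) (Set.Ici x) x)
    (hle : ∀ x ∈ Set.Ioo a b, f' x ≤ g' x) : f b - f a ≤ g b - g a := by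
  have key : ∀ c ∈ Set.Ioo a b, f b - f c ≤ g b - g c := by
    intro c hc
    have hsub : Set.Icc c b ⊆ Set.Icc a b := Set.Icc_subset_Icc_left hc.1.le
    have hsub' : ∀ x ∈ Set.Ico c b, x ∈ Set.Ioo a b := fun x hx => ⟨hc.1.trans_le hx.1, hx.2⟩
    have := image_le_of_deriv_right_le_deriv_boundary (f := fun x => f x - f c) (f' := f')
      (B := fun x => g x - g c) (B' := g')
      ((hf.mono hsub).sub continuousOn_const) (fun x hx => (hf' x (hsub' x hx)).sub_const _)
      (by simp) ((hg.mono hsub).sub continuousOn_const)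
      (fun x hx => (hg' x (hsub' x hx)).sub_const _) (fun x hx => hle x (hsub' x hx))
      (Set.right_mem_Icc.2 hc.2.le)
    exact this
  have hne : (nhdsWithin a (Set.Ioo a b)).NeBot := by
    rw [nhdsWithin_Ioo_eq_nhdsGT hab]; infer_instance
  have ha : a ∈ Set.Icc a b := Set.left_mem_Icc.2 hab.le
  refine le_of_tendsto_of_tendsto
    (Filter.Tendsto.const_sub (f b) ((hf a ha).mono_left (nhdsWithin_mono a Set.Ioo_subset_Icc_self)))
    (Filter.Tendsto.const_sub (g b) ((hg a ha).mono_left (nhdsWithin_mono a Set.Ioo_subset_Icc_self))) ?_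
  filter_upwards [self_mem_nhdsWithin] with c hc using key c hc

lemma calibration_deriv_le {p q t x f z w D z' : ℝ} (hp : 1 < p) (hpq : p < q)
    (ht : 0 < t) (hx : 0 < x) (hf : 0 < f) (hz : 0 < z) (hw : 0 < w) (hzw : z + w = 1)
    (hD : D = t ^ q * x ^ (-(q * ((p - 1) / p) + 1)) * f)
    (hz' : z' = (q * (p - 1) / (q - p) *
      (z ^ (q * (p - 1) / (q - p) - 1) * w ^ (q / (q - p) - 1)))⁻¹ * (-(q * ((p - 1) / p)) * D)) :
    (((q * ((p - 1) / p) + 1) * t ^ (q * ((p - 1) / p) + 1 - 1)) *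
        x ^ (-((q * ((p - 1) / p) + 1) * ((p - 1) / p))) +
      t ^ (q * ((p - 1) / p) + 1) * (f * (-((q * ((p - 1) / p) + 1) * ((p - 1) / p))) *
        x ^ (-((q * ((p - 1) / p) + 1) * ((p - 1) / p)) - 1))) * (z / w) ^ ((p - 1) / p) +
      t ^ (q * ((p - 1) / p) + 1) * x ^ (-((q * ((p - 1) / p) + 1) * ((p - 1) / p))) *
        ((z' * w - z * -z') / w ^ 2 * ((p - 1) / p) * (z / w) ^ ((p - 1) / p - 1)) -
      ((q * ((p - 1) / p) + 1) / p * (-(q * ((p - 1) / p)) * D) -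
        (q - p) * ((p - 1) / p) / p *
          ((z' * (q * (p - 1) / (q - p)) * z ^ (q * (p - 1) / (q - p) - 1)) * w ^ (q / (q - p) - 1) +
          z ^ (q * (p - 1) / (q - p)) * (-z' * (q / (q - p) - 1) * w ^ (q / (q - p) - 1 - 1)))) ≤
      (q * ((p - 1) / p) + 1) / p * f ^ (1 - p) := by
  have h1 := young_path (q := q) hp ht hx hf hz hw
  have h2 := amgm_path hp hpq ht hx hf hz hw
  rw [← hD] at h1 h2
  have hp0 : 0 < p := by linarith
  have hp1 : 0 < p - 1 := by linarith
  have hq0 : 0 < q := by linarith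
  have hqp : 0 < q - p := by linarith
  set σ := (p - 1) / p with hσ
  have hσ0 : 0 < σ := by positivity
  set α := q * (p - 1) / (q - p) with hα
  have hα0 : 0 < α := by positivity
  set β := q / (q - p) with hβ
  set b := q * σ + 1 with hb
  have hb1 : b - 1 = q * σ := by rw [hb]; ring
  rw [hb1, Real.rpow_sub_one hx.ne', Real.rpow_sub_one (div_pos hz hw).ne']
  rw [Real.rpow_sub_one hz.ne'] at hz' ⊢
  rw [Real.rpow_sub_one hw.ne' (β - 1), Real.rpow_sub_one hw.ne' β] at *
  rw [Real.rpow_neg hz.le, Real.rpow_neg hw.le] at h2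
  set B := t ^ b * x ^ (-(b * σ)) * (z / w) ^ σ with hB
  have hzα : 0 < z ^ α := by positivity
  have hwβ : 0 < w ^ β := by positivity
  set Y := t ^ (q * σ) * x ^ (-(b * σ)) * (z / w) ^ σ with hY
  have e3 : z' * α * (z ^ α / z) * (w ^ β / w) = -(q * σ) * D := by
    rw [hz']; field_simp
  have e4 : z ^ α * (-z' * (β - 1) * (w ^ β / w / w)) = z / w * D := by
    rw [hz']
    have : (β - 1) * (q * σ) = α := by
      rw [hβ, hσ, hα]; field_simp; ring
    field_simp
    linear_combination D * this
  have e2 : t ^ b * x ^ (-(b * σ)) * ((z' * w - z * -z') / w ^ 2 * σ * ((z / w) ^ σ / (z / w))) =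
      - (q * σ) * (B * ((q - p) / (p * q) * (D * (z ^ α)⁻¹ * (w ^ β)⁻¹))) := by
    have : z' * w - z * -z' = z' := by linear_combination z' * hzw
    rw [this, hz', hB]
    have : σ / α = (q - p) / (p * q) := by
      rw [hα, hσ]; field_simp
    rw [← this]
    field_simp
  have e1 : (b * t ^ (q * σ) * x ^ (-(b * σ)) + t ^ b * (f * -(b * σ) * (x ^ (-(b * σ)) / x))) *
      (z / w) ^ σ = b * Y - (q * σ) * (B * (b / q * (f / x))) := by
    rw [hY, hB]; field_simp; ring
  rw [e1, e2, e3, e4]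
  have hbpos : 0 < b := by positivity
  have h1' := mul_le_mul_of_nonneg_left h1 hbpos.le
  have h2' := mul_le_mul_of_nonneg_left h2 (by positivity : 0 ≤ q * σ)
  have hDw : D / w = D + z / w * D := by
    field_simp; linear_combination -D * hzw
  rw [hDw] at h2'
  have i1 : b / p - (q - p) * σ / p = 1 := by rw [hb, hσ]; field_simp; ring
  have i2 : b * σ - q * σ + (q - p) * σ / p = 0 := by rw [hb, hσ]; field_simp; ring
  have : b * (1 / p * f ^ (1 - p) + σ * (z / w * D)) - q * σ * (D + z / w * D)
      - (b / p * (-(q * σ) * D) - (q - p) * σ / p * (-(q * σ) * D + z / w * D)) =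
      b / p * f ^ (1 - p) := by
    linear_combination (q * σ * D) * i1 + (z / w * D) * i2
  nlinarith

/-- The unnormalised incomplete Beta function. -/
def incBeta (α β z : ℝ) : ℝ := α * ∫ s in (0 : ℝ)..z, s ^ (α - 1) * (1 - s) ^ (β - 1)

lemma incBeta_zero (α β : ℝ) : incBeta α β 0 = 0 := by simp [incBeta]

lemma intervalIntegrable_beta {α β : ℝ} (hα : 0 < α) (hβ : 1 ≤ β) (a b : ℝ) :
    IntervalIntegrable (fun s : ℝ => s ^ (α - 1) * (1 - s) ^ (β - 1)) volume a b := by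
  refine (intervalIntegral.intervalIntegrable_rpow' (by linarith)).mul_continuousOn ?_
  exact ((continuous_const.sub continuous_id).rpow_const
    (fun _ => Or.inr (by linarith))).continuousOn

lemma continuous_incBeta {α β : ℝ} (hα : 0 < α) (hβ : 1 ≤ β) : Continuous (incBeta α β) :=
  continuous_const.mul
    (intervalIntegral.continuous_primitive (fun a b => intervalIntegrable_beta hα hβ a b) 0)

lemma hasDerivAt_incBeta {α β z : ℝ} (hα : 0 < α) (hβ : 1 ≤ β) (hz : z ∈ Set.Ioo (0 : ℝ) 1) :
    HasDerivAt (incBeta α β) (α * (z ^ (α - 1) * (1 - z) ^ (β - 1))) z := by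
  refine HasDerivAt.const_mul α (intervalIntegral.integral_hasDerivAt_right
    (intervalIntegrable_beta hα hβ 0 z) ?_ ?_)
  · exact (Measurable.stronglyMeasurable (by fun_prop)).stronglyMeasurableAtFilter
  · exact (Real.continuousAt_rpow_const _ _ (Or.inl hz.1.ne')).mul
      ((continuous_const.sub continuous_id).continuousAt.rpow_const
        (Or.inl (sub_pos.2 hz.2).ne'))

lemma incBeta_one {α β : ℝ} (hα : 0 < α) (hβ : 1 ≤ β) :
    incBeta α β 1 = Real.Gamma β * Real.Gamma (α + 1) / Real.Gamma (α + β) := by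
  have h := ProbabilityTheory.beta_eq_betaIntegralReal α β hα (by linarith)
  have h2 : Complex.betaIntegral α β =
      ((∫ s in (0 : ℝ)..1, s ^ (α - 1) * (1 - s) ^ (β - 1) : ℝ) : ℂ) := by
    rw [Complex.betaIntegral, ← intervalIntegral.integral_ofReal]
    refine intervalIntegral.integral_congr fun s hs => ?_
    rw [Set.uIcc_of_le zero_le_one] at hs
    push_cast
    rw [Complex.ofReal_cpow hs.1, Complex.ofReal_cpow (by linarith [hs.2])]
    push_cast
    rfl
  rw [h2, Complex.ofReal_re] at h
  rw [incBeta, ← h, ProbabilityTheory.beta, Real.Gamma_add_one hα.ne']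
  ring

lemma continuousOn_rpow_mul_rpow_neg {ψ : ℝ → ℝ} {T c e d : ℝ} (hc : 0 < c)
    (hψ : ContinuousOn ψ (Set.Icc 0 T)) (hlow : ∀ t ∈ Set.Icc 0 T, c * t ≤ ψ t)
    (hd : 0 ≤ d) (hde : d < e) :
    ContinuousOn (fun t => t ^ e * ψ t ^ (-d)) (Set.Icc 0 T) := by
  intro t ht
  rcases ht.1.eq_or_lt with rfl | htpos
  · have h0 : (0 : ℝ) ^ e * ψ 0 ^ (-d) = 0 := by
      rw [Real.zero_rpow (by linarith), zero_mul]
    rw [ContinuousWithinAt, h0]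
    have hlim : Filter.Tendsto (fun t : ℝ => c ^ (-d) * t ^ (e - d)) (nhdsWithin 0 (Set.Icc 0 T))
        (nhds 0) := by
      have : ContinuousAt (fun t : ℝ => c ^ (-d) * t ^ (e - d)) 0 :=
        continuousAt_const.mul (Real.continuousAt_rpow_const _ _ (Or.inr (by linarith)))
      have h2 := this.tendsto
      simp only [Real.zero_rpow (by linarith : e - d ≠ 0), mul_zero] at h2
      exact h2.mono_left nhdsWithin_le_nhds
    refine squeeze_zero' ?_ ?_ hlim
    · filter_upwards [self_mem_nhdsWithin] with s hs
      have : 0 ≤ ψ s := le_trans (mul_nonneg hc.le hs.1) (hlow s hs)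
      have := hs.1
      positivity
    · filter_upwards [self_mem_nhdsWithin] with s hs
      rcases hs.1.eq_or_lt with rfl | hs0
      · rw [h0, Real.zero_rpow (by linarith), mul_zero]
      · have h1 : ψ s ^ (-d) ≤ (c * s) ^ (-d) :=
          Real.rpow_le_rpow_of_nonpos (by positivity) (hlow s hs) (by linarith)
        calc s ^ e * ψ s ^ (-d) ≤ s ^ e * (c * s) ^ (-d) := by gcongr
          _ = c ^ (-d) * s ^ (e - d) := by
            rw [Real.mul_rpow hc.le hs0.le, sub_eq_add_neg e d, Real.rpow_add hs0]; ring
  · have hψt : 0 < ψ t := lt_of_lt_of_le (by positivity) (hlow t ht)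
    exact (Real.continuousAt_rpow_const _ _ (Or.inl htpos.ne')).continuousWithinAt.mul
      ((hψ t ht).rpow_const (Or.inl hψt.ne'))

lemma bliss_calibration {p q T c z : ℝ} {ψ φ G : ℝ → ℝ} (hp : 1 < p) (hpq : p < q) (hT : 0 < T)
    (hc : 0 < c) (hψ : ContinuousOn ψ (Set.Icc 0 T)) (hlow : ∀ t ∈ Set.Icc 0 T, c * t ≤ ψ t)
    (hψ' : ∀ t ∈ Set.Ioo 0 T, HasDerivWithinAt ψ (φ t) (Set.Ici t) t)
    (hφ : ∀ t ∈ Set.Ioo 0 T, 0 < φ t) (hG : ContinuousOn G (Set.Icc 0 T))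
    (hG' : ∀ t ∈ Set.Ioo 0 T, HasDerivWithinAt G (φ t ^ (1 - p)) (Set.Ici t) t)
    (hz : z ∈ Set.Ioo (0 : ℝ) 1)
    (hL : q * (∫ t in (0 : ℝ)..T, t ^ (q - 1) * ψ t ^ (-(q * ((p - 1) / p)))) -
      T ^ q * ψ T ^ (-(q * ((p - 1) / p))) = incBeta (q * (p - 1) / (q - p)) (q / (q - p)) z) :
    (q * ((p - 1) / p) + 1) / p * incBeta (q * (p - 1) / (q - p)) (q / (q - p)) z -
      (q - p) * ((p - 1) / p) / p * (z ^ (q * (p - 1) / (q - p)) * (1 - z) ^ (q / (q - p) - 1)) ≤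
      (q * ((p - 1) / p) + 1) / p * (G T - G 0) := by
  have hp0 : 0 < p := by linarith
  have hp1 : 0 < p - 1 := by linarith
  have hq0 : 0 < q := by linarith
  have hqp : 0 < q - p := by linarith
  set σ := (p - 1) / p with hσ
  have hσ0 : 0 < σ := by positivity
  have hσ1 : q * σ < q - 1 := by
    rw [hσ, ← mul_div_assoc, div_lt_iff₀ hp0]; nlinarith
  have hσ2 : σ < 1 := by rw [hσ, div_lt_one hp0]; linarith
  set α := q * (p - 1) / (q - p) with hα
  have hα0 : 0 < α := by positivity
  set β := q / (q - p) with hβ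
  have hβ1 : 1 < β := by rw [hβ, one_lt_div hqp]; linarith
  set b := q * σ + 1 with hb
  have hb0 : 0 < b := by positivity
  have hψpos : ∀ t ∈ Set.Ioc 0 T, 0 < ψ t := fun t ht =>
    lt_of_lt_of_le (mul_pos hc ht.1) (hlow t ⟨ht.1.le, ht.2⟩)
  -- the transported mass
  have hmc : ContinuousOn (fun t => t ^ (q - 1) * ψ t ^ (-(q * σ))) (Set.Icc 0 T) :=
    continuousOn_rpow_mul_rpow_neg hc hψ hlow (by positivity) hσ1
  have hmc2 : ContinuousOn (fun t => t ^ q * ψ t ^ (-(q * σ))) (Set.Icc 0 T) :=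
    continuousOn_rpow_mul_rpow_neg hc hψ hlow (by positivity) (by linarith)
  set m : ℝ → ℝ := fun t => t ^ (q - 1) * ψ t ^ (-(q * σ)) with hm
  have hmi : IntervalIntegrable m volume 0 T :=
    ContinuousOn.intervalIntegrable (by rwa [Set.uIcc_of_le hT.le])
  set J : ℝ → ℝ := fun t => q * ((∫ s in (0 : ℝ)..T, m s) - ∫ s in (0 : ℝ)..t, m s) +
    t ^ q * ψ t ^ (-(q * σ)) - T ^ q * ψ T ^ (-(q * σ)) with hJ
  have hJT : J T = 0 := by simp [hJ]
  have hJ0 : J 0 = incBeta α β z := by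
    rw [← hL]; simp only [hJ, intervalIntegral.integral_same, sub_zero]
    rw [Real.zero_rpow hq0.ne']; ring
  have hprim : ContinuousOn (fun t => ∫ s in (0 : ℝ)..t, m s) (Set.Icc 0 T) := by
    have := intervalIntegral.continuousOn_primitive_interval (a := (0 : ℝ)) (b := T)
      (f := m) (μ := volume) (by
        rw [Set.uIcc_of_le hT.le]
        exact hmc.integrableOn_Icc)
    rwa [Set.uIcc_of_le hT.le] at this
  have hJc : ContinuousOn J (Set.Icc 0 T) :=
    ((continuousOn_const.mul (continuousOn_const.sub hprim)).add hmc2).sub continuousOn_const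
  set D : ℝ → ℝ := fun t => t ^ q * ψ t ^ (-b) * φ t with hD
  have hDpos : ∀ t ∈ Set.Ioo 0 T, 0 < D t := fun t ht => by
    have := ht.1
    have := hψpos t ⟨ht.1, ht.2.le⟩
    have := hφ t ht
    positivity
  have hJ' : ∀ t ∈ Set.Ioo 0 T, HasDerivWithinAt J (-(q * σ) * D t) (Set.Ici t) t := by
    intro t ht
    have hψt := hψpos t ⟨ht.1, ht.2.le⟩
    have hmeas : StronglyMeasurableAtFilter m (nhds t) volume :=
      ContinuousOn.stronglyMeasurableAtFilter_nhdsWithin (s := Set.Ioo 0 T)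
        (hmc.mono Set.Ioo_subset_Icc_self) measurableSet_Ioo t |>.filter_mono
        (by rw [isOpen_Ioo.nhdsWithin_eq ht])
    have h1 : HasDerivAt (fun t => ∫ s in (0 : ℝ)..t, m s) (m t) t :=
      intervalIntegral.integral_hasDerivAt_right
        (hmi.mono_set (by
          rw [Set.uIcc_of_le ht.1.le, Set.uIcc_of_le hT.le]
          exact Set.Icc_subset_Icc_right ht.2.le))
        hmeas (hmc.continuousAt (Icc_mem_nhds ht.1 ht.2))
    have h2 : HasDerivWithinAt (fun t => ψ t ^ (-(q * σ)))
        (φ t * (-(q * σ)) * ψ t ^ (-(q * σ) - 1)) (Set.Ici t) t :=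
      (hψ' t ht).rpow_const (Or.inl hψt.ne')
    have h3 : HasDerivWithinAt (fun t : ℝ => t ^ q) (q * t ^ (q - 1)) (Set.Ici t) t :=
      (Real.hasDerivAt_rpow_const (Or.inl ht.1.ne')).hasDerivWithinAt
    have h4 := (((h1.const_sub (∫ s in (0 : ℝ)..T, m s)).const_mul q).hasDerivWithinAt
      (s := Set.Ici t) |>.add (h3.mul h2)).sub_const (T ^ q * ψ T ^ (-(q * σ)))
    refine h4.congr_deriv ?_
    simp only [hm, hD]
    rw [show -b = -(q * σ) - 1 by rw [hb]; ring]
    ring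
  have hanti : ∀ s ∈ Set.Icc 0 T, ∀ t ∈ Set.Icc 0 T, s ≤ t → J t ≤ J s := by
    intro s hs t ht hst
    rcases hst.eq_or_lt with rfl | hst
    · exact le_rfl
    have hsub := Set.Icc_subset_Icc hs.1 ht.2
    have hsub' : Set.Ioo s t ⊆ Set.Ioo 0 T := Set.Ioo_subset_Ioo hs.1 ht.2
    have := sub_le_sub_of_right_deriv_le (g := fun _ => (0 : ℝ)) (g' := fun _ => 0)
      hst (hJc.mono hsub) continuousOn_const
      (fun x hx => hJ' x (hsub' hx)) (fun x hx => hasDerivWithinAt_const _ _ _)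
      (fun x hx => by
        have := hDpos x (hsub' hx)
        have : 0 < q * σ * D x := by positivity
        linarith)
    linarith
  have hJlt : ∀ t ∈ Set.Ico 0 T, 0 < J t := by
    have hpos : ∀ t ∈ Set.Ioo 0 T, 0 < J t := by
      intro t ht
      by_contra hneg
      have hz : ∀ s ∈ Set.Icc t T, J s = 0 := by
        intro s hs
        have hs' : s ∈ Set.Icc 0 T := ⟨ht.1.le.trans hs.1, hs.2⟩
        have h1 := hanti t ⟨ht.1.le, ht.2.le⟩ s hs' hs.1
        have h2 := hanti s hs' T ⟨hT.le, le_rfl⟩ hs.2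
        linarith
      have h1 : HasDerivWithinAt J 0 (Set.Ici t) t := by
        refine (hasDerivWithinAt_const t (Set.Ici t) (0 : ℝ)).congr_of_eventuallyEq ?_
          (hz t ⟨le_rfl, ht.2.le⟩)
        filter_upwards [Icc_mem_nhdsGE ht.2] with s hs using hz s hs
      have h2 := (uniqueDiffOn_Ici t t Set.self_mem_Ici).eq_deriv _ (hJ' t ht) h1
      have := hDpos t ht
      have : 0 < q * σ * D t := by positivity
      linarith
    intro t ht
    rcases ht.1.eq_or_lt with rfl | h
    · have hmid : T / 2 ∈ Set.Ioo 0 T := ⟨by linarith, by linarith⟩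
      exact (hpos _ hmid).trans_le (hanti 0 ⟨le_rfl, hT.le⟩ _ ⟨hmid.1.le, hmid.2.le⟩ hmid.1.le)
    · exact hpos t ⟨h, ht.2⟩
  obtain ⟨hmono, g, hgc, hgmem, hfg, hgf, hgIoo, hgd⟩ := exists_inverse
    (continuous_incBeta hα0 hβ1.le).continuousOn
    (fun x hx => hasDerivAt_incBeta hα0 hβ1.le hx)
    (fun x hx => by
      have := hx.1
      have : 0 < 1 - x := sub_pos.2 hx.2
      positivity) (incBeta_zero α β)
  have hz1 : incBeta α β z < incBeta α β 1 :=
    hmono ⟨hz.1.le, hz.2.le⟩ (Set.right_mem_Icc.2 zero_le_one) hz.2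
  have hJmem : ∀ t ∈ Set.Icc 0 T, J t ∈ Set.Icc 0 (incBeta α β 1) := fun t ht =>
    ⟨hJT ▸ hanti t ht T (Set.right_mem_Icc.2 hT.le) ht.2,
      (hanti 0 (Set.left_mem_Icc.2 hT.le) t ht ht.1).trans (hJ0 ▸ hz1.le)⟩
  set ζ : ℝ → ℝ := fun t => g (J t) with hζ
  have hζle : ∀ t ∈ Set.Icc 0 T, ζ t ≤ z := by
    intro t ht
    refine (hmono.le_iff_le (hgmem _ (hJmem t ht)) ⟨hz.1.le, hz.2.le⟩).1 ?_
    rw [hfg _ (hJmem t ht), ← hJ0]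
    exact hanti 0 (Set.left_mem_Icc.2 hT.le) t ht ht.1
  have hζ0 : ζ 0 = z := by
    simp only [hζ, hJ0]; exact hgf z ⟨hz.1.le, hz.2.le⟩
  have hζT : ζ T = 0 := by
    simp only [hζ, hJT]
    simpa [incBeta_zero] using hgf 0 (Set.left_mem_Icc.2 zero_le_one)
  have hζc : ContinuousOn ζ (Set.Icc 0 T) := hgc.comp hJc hJmem
  have hζpos : ∀ t ∈ Set.Ioo 0 T, ζ t ∈ Set.Ioo (0 : ℝ) 1 := fun t ht =>
    hgIoo _ ⟨hJlt t ⟨ht.1.le, ht.2⟩,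
      (hanti 0 (Set.left_mem_Icc.2 hT.le) t ⟨ht.1.le, ht.2.le⟩ ht.1.le).trans_lt (hJ0 ▸ hz1)⟩
  set ζ' : ℝ → ℝ := fun t => (α * (ζ t ^ (α - 1) * (1 - ζ t) ^ (β - 1)))⁻¹ * (-(q * σ) * D t)
    with hζ'
  have hζd : ∀ t ∈ Set.Ioo 0 T, HasDerivWithinAt ζ (ζ' t) (Set.Ici t) t := fun t ht =>
    (hgd _ ⟨hJlt t ⟨ht.1.le, ht.2⟩,
      (hanti 0 (Set.left_mem_Icc.2 hT.le) t ⟨ht.1.le, ht.2.le⟩ ht.1.le).trans_lt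
        (hJ0 ▸ hz1)⟩).comp_hasDerivWithinAt t (hJ' t ht)
  have hw : ∀ t ∈ Set.Icc 0 T, 0 < 1 - ζ t := fun t ht => by linarith [hζle t ht, hz.2]
  set H : ℝ → ℝ := fun t => t ^ b * ψ t ^ (-(b * σ)) * (ζ t / (1 - ζ t)) ^ σ -
    (b / p * J t - (q - p) * σ / p * (ζ t ^ α * (1 - ζ t) ^ (β - 1))) with hH
  have hHc : ContinuousOn H (Set.Icc 0 T) := by
    refine ((continuousOn_rpow_mul_rpow_neg hc hψ hlow (by positivity) (by nlinarith)).mul ?_).sub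
      ((continuousOn_const.mul hJc).sub (continuousOn_const.mul (ContinuousOn.mul ?_ ?_)))
    · exact (hζc.div (continuousOn_const.sub hζc) (fun t ht => (hw t ht).ne')).rpow_const
        (fun _ _ => Or.inr hσ0.le)
    · exact hζc.rpow_const (fun _ _ => Or.inr hα0.le)
    · exact (continuousOn_const.sub hζc).rpow_const (fun _ _ => Or.inr (by linarith))
  have hmain := sub_le_sub_of_right_deriv_le hT hHc (continuousOn_const.mul hG) (f' := fun t =>
      ((b * t ^ (b - 1)) * ψ t ^ (-(b * σ)) +
        t ^ b * (φ t * (-(b * σ)) * ψ t ^ (-(b * σ) - 1))) * (ζ t / (1 - ζ t)) ^ σ +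
      t ^ b * ψ t ^ (-(b * σ)) *
        ((ζ' t * (1 - ζ t) - ζ t * -ζ' t) / (1 - ζ t) ^ 2 * σ * (ζ t / (1 - ζ t)) ^ (σ - 1)) -
      (b / p * (-(q * σ) * D t) - (q - p) * σ / p *
          ((ζ' t * α * ζ t ^ (α - 1)) * (1 - ζ t) ^ (β - 1) +
          ζ t ^ α * (-ζ' t * (β - 1) * (1 - ζ t) ^ (β - 1 - 1)))))
    (g' := fun t => b / p * φ t ^ (1 - p)) ?_ (fun t ht => (hG' t ht).const_mul (b / p)) ?_
  · have h0 : H 0 = - (b / p * incBeta α β z - (q - p) * σ / p * (z ^ α * (1 - z) ^ (β - 1))) := by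
      simp only [hH, hζ0, hJ0, Real.zero_rpow hb0.ne']; ring
    have h1 : H T = 0 := by
      simp only [hH, hζT, hJT, Real.zero_rpow hα0.ne', zero_div, Real.zero_rpow hσ0.ne']; ring
    rw [h0, h1] at hmain
    simp only [Pi.mul_apply] at hmain
    linarith
  · intro t ht
    have hψt := hψpos t ⟨ht.1, ht.2.le⟩
    have hwt := hw t ⟨ht.1.le, ht.2.le⟩
    have hζt := (hζpos t ht).1
    have d1 : HasDerivWithinAt (fun t : ℝ => t ^ b) (b * t ^ (b - 1)) (Set.Ici t) t :=
      (Real.hasDerivAt_rpow_const (Or.inl ht.1.ne')).hasDerivWithinAt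
    have d2 := (hψ' t ht).rpow_const (p := -(b * σ)) (Or.inl hψt.ne')
    have dw := (hζd t ht).const_sub 1
    have d3 := ((hζd t ht).div dw hwt.ne').rpow_const (p := σ) (Or.inl (div_pos hζt hwt).ne')
    have d4 := (hζd t ht).rpow_const (p := α) (Or.inl hζt.ne')
    have d5 := dw.rpow_const (p := β - 1) (Or.inl hwt.ne')
    exact ((d1.mul d2).mul d3).sub
      (((hJ' t ht).const_mul (b / p)).sub ((d4.mul d5).const_mul ((q - p) * σ / p)))
  · intro t ht
    exact calibration_deriv_le hp hpq ht.1 (hψpos t ⟨ht.1, ht.2.le⟩) (hφ t ht) (hζpos t ht).1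
      (hw t ⟨ht.1.le, ht.2.le⟩) (by ring) rfl rfl

lemma incBeta_one_pos {α β : ℝ} (hα : 0 < α) (hβ : 1 ≤ β) : 0 < incBeta α β 1 := by
  rw [incBeta_one hα hβ]
  have := Real.Gamma_pos_of_pos (show 0 < β by linarith)
  have := Real.Gamma_pos_of_pos (show 0 < α + 1 by linarith)
  have := Real.Gamma_pos_of_pos (show 0 < α + β by linarith)
  positivity

lemma incBeta_pos {α β z : ℝ} (hα : 0 < α) (hβ : 1 ≤ β) (hz : z ∈ Set.Ioo (0 : ℝ) 1) :
    0 < incBeta α β z := by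
  have h := (exists_inverse (continuous_incBeta hα hβ).continuousOn
    (fun x hx => hasDerivAt_incBeta hα hβ hx)
    (fun x hx => by
      have := hx.1
      have : 0 < 1 - x := sub_pos.2 hx.2
      positivity) (incBeta_zero α β)).1 ⟨le_rfl, zero_le_one⟩ ⟨hz.1.le, hz.2.le⟩ hz.1
  rwa [incBeta_zero] at h

/-- Bliss' inequality, for a path `ψ` with piecewise continuous slope `φ`. -/
lemma bliss_inequality {p q T c : ℝ} {ψ φ G : ℝ → ℝ} (hp : 1 < p) (hpq : p < q) (hT : 0 < T)
    (hc : 0 < c) (hψ : ContinuousOn ψ (Set.Icc 0 T)) (hlow : ∀ t ∈ Set.Icc 0 T, c * t ≤ ψ t)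
    (hψ' : ∀ t ∈ Set.Ioo 0 T, HasDerivWithinAt ψ (φ t) (Set.Ici t) t)
    (hφ : ∀ t ∈ Set.Ioo 0 T, 0 < φ t) (hG : ContinuousOn G (Set.Icc 0 T))
    (hG' : ∀ t ∈ Set.Ioo 0 T, HasDerivWithinAt G (φ t ^ (1 - p)) (Set.Ici t) t)
    (hG0 : G 0 ≤ G T) :
    q * (∫ t in (0 : ℝ)..T, t ^ (q - 1) * ψ t ^ (-(q * ((p - 1) / p)))) -
      T ^ q * ψ T ^ (-(q * ((p - 1) / p))) ≤
    incBeta (q * (p - 1) / (q - p)) (q / (q - p)) 1 ^ (1 - q / p) * (G T - G 0) ^ (q / p) := by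
  have hp0 : 0 < p := by linarith
  have hp1 : 0 < p - 1 := by linarith
  have hq0 : 0 < q := by linarith
  have hqp : 0 < q - p := by linarith
  have hα0 : 0 < q * (p - 1) / (q - p) := by positivity
  have hβ1 : 1 < q / (q - p) := by rw [one_lt_div hqp]; linarith
  have hI1 := incBeta_one_pos hα0 hβ1.le
  set L := q * (∫ t in (0 : ℝ)..T, t ^ (q - 1) * ψ t ^ (-(q * ((p - 1) / p)))) -
      T ^ q * ψ T ^ (-(q * ((p - 1) / p))) with hL
  rcases le_or_gt L 0 with hL0 | hL0
  · refine hL0.trans (mul_nonneg (by positivity) (Real.rpow_nonneg (by linarith) _))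
  set α := q * (p - 1) / (q - p) with hα
  set β := q / (q - p) with hβ
  set d := q * ((p - 1) / p) with hd
  have hd0 : 0 < d := by positivity
  have hψ0 : ∀ t ∈ Set.Icc 0 T, 0 ≤ ψ t := fun t ht =>
    (mul_nonneg hc.le ht.1).trans (hlow t ht)
  have key : ∀ z ∈ Set.Ioo (0 : ℝ) 1, (d + 1) / p * incBeta α β z -
      (q - p) * ((p - 1) / p) / p * (z ^ α * (1 - z) ^ (β - 1)) ≤
      (d + 1) / p * ((incBeta α β z / L) ^ (p / q) * (G T - G 0)) := by
    intro z hz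
    have hI := incBeta_pos hα0 hβ1.le hz
    set k := (incBeta α β z / L) ^ (-(1 / d)) with hk
    have hk0 : 0 < k := by positivity
    have hkd : k ^ (-d) = incBeta α β z / L := by
      rw [hk, ← Real.rpow_mul (by positivity)]
      rw [show -(1 / d) * -d = 1 by field_simp, Real.rpow_one]
    have hkp : k ^ (1 - p) = (incBeta α β z / L) ^ (p / q) := by
      rw [hk, ← Real.rpow_mul (by positivity)]
      congr 1
      rw [hd]; field_simp; ring
    have hscale : ∀ t ∈ Set.Icc 0 T, (k * ψ t) ^ (-d) = incBeta α β z / L * ψ t ^ (-d) :=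
      fun t ht => by rw [Real.mul_rpow hk0.le (hψ0 t ht), hkd]
    have := bliss_calibration (ψ := fun t => k * ψ t) (φ := fun t => k * φ t)
      (G := fun t => k ^ (1 - p) * G t) (c := k * c) (z := z) hp hpq hT (by positivity)
      (continuousOn_const.mul hψ)
      (fun t ht => by
        have := mul_le_mul_of_nonneg_left (hlow t ht) hk0.le
        simpa [mul_assoc] using this)
      (fun t ht => (hψ' t ht).const_mul k) (fun t ht => mul_pos hk0 (hφ t ht))
      (continuousOn_const.mul hG)
      (fun t ht => by
        rw [Real.mul_rpow hk0.le (hφ t ht).le]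
        exact (hG' t ht).const_mul _) hz
      (by
        rw [← hd, hscale T ⟨hT.le, le_rfl⟩]
        have : ∫ t in (0 : ℝ)..T, t ^ (q - 1) * (k * ψ t) ^ (-d) =
            incBeta α β z / L * ∫ t in (0 : ℝ)..T, t ^ (q - 1) * ψ t ^ (-d) := by
          rw [← intervalIntegral.integral_const_mul]
          refine intervalIntegral.integral_congr fun t ht => ?_
          rw [Set.uIcc_of_le hT.le] at ht
          simp only [hscale t ht]; ring
        rw [this]
        have : incBeta α β z = incBeta α β z / L * L := by field_simp
        conv_rhs => rw [← hα, ← hβ, this, hL]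
        ring)
    refine this.trans (le_of_eq ?_)
    rw [hkp]; ring
  have c1 : ContinuousAt (fun z => (d + 1) / p * incBeta α β z -
      (q - p) * ((p - 1) / p) / p * (z ^ α * (1 - z) ^ (β - 1))) 1 := by
    refine (continuousAt_const.mul (continuous_incBeta hα0 hβ1.le).continuousAt).sub
      (continuousAt_const.mul ((Real.continuousAt_rpow_const _ _ (Or.inr hα0.le)).mul ?_))
    exact (continuousAt_const.sub continuousAt_id).rpow_const (Or.inr (by linarith))
  have c2 : ContinuousAt (fun z =>
      (d + 1) / p * ((incBeta α β z / L) ^ (p / q) * (G T - G 0))) 1 :=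
    continuousAt_const.mul ((((continuous_incBeta hα0 hβ1.le).continuousAt.div_const L).rpow_const
      (Or.inr (by positivity))).mul continuousAt_const)
  have hlim := le_of_tendsto_of_tendsto
    (c1.tendsto.mono_left (nhdsWithin_le_nhds (s := Set.Iio 1)))
    (c2.tendsto.mono_left nhdsWithin_le_nhds)
    (by filter_upwards [Ioo_mem_nhdsLT zero_lt_one] with z hz using key z hz)
  rw [sub_self, Real.zero_rpow (by linarith), mul_zero, mul_zero, sub_zero] at hlim
  have hlim := le_of_mul_le_mul_left hlim (by positivity)
  set I := incBeta α β 1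
  set E := G T - G 0
  have hE : I * (I / L) ^ (-(p / q)) ≤ E := by
    rw [Real.rpow_neg (by positivity), ← div_eq_mul_inv, div_le_iff₀ (by positivity)]
    linarith
  have h2 := Real.rpow_le_rpow (by positivity) hE (show 0 ≤ q / p by positivity)
  rw [Real.mul_rpow hI1.le (by positivity), ← Real.rpow_mul (by positivity),
    show -(p / q) * (q / p) = -1 by field_simp, Real.rpow_neg_one] at h2
  calc L = I ^ (1 - q / p) * (I ^ (q / p) * (I / L)⁻¹) := by
        rw [← mul_assoc, ← Real.rpow_add hI1]; simp; field_simp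
    _ ≤ _ := by gcongr

section Capacity

variable {n : ℕ}

lemma capPA_nonneg (p a : ℝ) (K Ω : Set (EuclideanSpace ℝ (Fin n))) : 0 ≤ capPA p a K Ω := by
  refine Real.sInf_nonneg ?_
  rintro r ⟨v, -, -, -, -, rfl⟩
  exact integral_nonneg fun x => by positivity

lemma capPA_le {p a : ℝ} {K Ω : Set (EuclideanSpace ℝ (Fin n))}
    {v : EuclideanSpace ℝ (Fin n) → ℝ} (hv : ContDiff ℝ (⊤ : ℕ∞) v) (hc : HasCompactSupport v)
    (hs : tsupport v ⊆ Ω) (h1 : ∀ x ∈ K, 1 ≤ v x) :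
    capPA p a K Ω ≤ ∫ x in Ω, ‖fderiv ℝ v x‖ ^ p * ‖x‖ ^ (-a) := by
  refine csInf_le ⟨0, ?_⟩ ⟨v, hv, hc, hs, h1, rfl⟩
  rintro r ⟨v, -, -, -, -, rfl⟩
  exact integral_nonneg fun x => by positivity

lemma capPA_empty {p a : ℝ} (hp : p ≠ 0) (Ω : Set (EuclideanSpace ℝ (Fin n))) :
    capPA p a ∅ Ω = 0 := by
  refine le_antisymm ?_ (capPA_nonneg _ _ _ _)
  refine (capPA_le (v := fun _ => 0) contDiff_const HasCompactSupport.zero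
    (by simp [tsupport]) (by simp)).trans (le_of_eq ?_)
  simp [Real.zero_rpow hp]

/-- Testing the capacity of a superlevel set with a smooth truncation of `|u|`. -/
lemma capPA_mul_integral_rpow_le {p a t : ℝ} (hp : 0 < p) (ht : 0 ≤ t)
    {Ω : Set (EuclideanSpace ℝ (Fin n))}
    {u : EuclideanSpace ℝ (Fin n) → ℝ} (hu : ContDiff ℝ (⊤ : ℕ∞) u)
    (hc : HasCompactSupport u) (hsupp : tsupport u ⊆ Ω) {χ : ℝ → ℝ}
    (hχ : ContDiff ℝ (⊤ : ℕ∞) χ) (hχ0 : ∀ s, 0 ≤ χ s) (hχneg : ∀ s ≤ 0, χ s = 0) :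
    capPA p a {x ∈ Ω | t ≤ |u x|} Ω * (∫ s in (0 : ℝ)..t, χ s) ^ p ≤
      ∫ x in Ω, χ |u x| ^ p * (‖fderiv ℝ u x‖ ^ p * ‖x‖ ^ (-a)) := by
  set k : ℝ → ℝ := fun s => ∫ τ in (0 : ℝ)..s, χ τ with hk
  have hkd : ∀ s, HasDerivAt k (χ s) s := fun s =>
    (hχ.continuous.integral_hasStrictDerivAt 0 s).hasDerivAt
  have hksm : ContDiff ℝ (⊤ : ℕ∞) k := by
    rw [contDiff_infty_iff_deriv]
    refine ⟨fun s => (hkd s).differentiableAt, ?_⟩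
    rwa [show deriv k = χ from funext fun s => (hkd s).deriv]
  have hkmono : Monotone k := monotone_of_hasDerivAt_nonneg hkd hχ0
  have hk0 : k 0 = 0 := by simp [hk]
  have hkneg : ∀ s ≤ 0, k s = 0 := by
    intro s hs
    simp only [hk]
    rw [intervalIntegral.integral_congr (g := fun _ => (0 : ℝ)), intervalIntegral.integral_zero]
    intro τ hτ
    rw [Set.uIcc_of_ge hs] at hτ
    exact hχneg τ hτ.2
  rcases (hk0 ▸ hkmono ht : 0 ≤ k t).eq_or_lt with h0 | hkt
  · change _ * k t ^ p ≤ _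
    rw [← h0, Real.zero_rpow hp.ne', mul_zero]
    exact integral_nonneg fun x => by have := hχ0 |u x|; positivity
  change _ * k t ^ p ≤ _
  set F : ℝ → ℝ := fun s => (k s + k (-s)) / k t with hF
  have hFabs : ∀ s, F s = k |s| / k t := by
    intro s
    rcases le_total 0 s with hs | hs
    · simp only [hF, abs_of_nonneg hs, hkneg (-s) (by linarith), add_zero]
    · simp only [hF, abs_of_nonpos hs, hkneg s hs, zero_add]
  have hFd : ∀ s, HasDerivAt F ((χ s - χ (-s)) / k t) s := by
    intro s
    have := ((hkd s).add ((hkd (-s)).comp s (hasDerivAt_neg s))).div_const (k t)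
    simpa [hF, sub_eq_add_neg] using this
  have hFd' : ∀ s, |(χ s - χ (-s)) / k t| = χ |s| / k t := by
    intro s
    rw [abs_div, abs_of_pos hkt]
    rcases le_total 0 s with hs | hs
    · rw [hχneg (-s) (by linarith), sub_zero, abs_of_nonneg (hχ0 s), abs_of_nonneg hs]
    · rw [hχneg s hs, zero_sub, abs_neg, abs_of_nonneg (hχ0 _), abs_of_nonpos hs]
  have hFsm : ContDiff ℝ (⊤ : ℕ∞) F := (hksm.add (hksm.comp contDiff_neg)).div_const _
  have hF0 : F 0 = 0 := by simp [hFabs, hk0]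
  have hts : tsupport (F ∘ u) ⊆ tsupport u := closure_mono (Function.support_comp_subset hF0 u)
  have hle := capPA_le (p := p) (a := a) (K := {x ∈ Ω | t ≤ |u x|}) (hFsm.comp hu)
    (hc.comp_left hF0) (hts.trans hsupp) (fun x hx => by
      rw [Function.comp_apply, hFabs, one_le_div hkt]
      exact hkmono hx.2)
  have hint : ∫ x in Ω, ‖fderiv ℝ (F ∘ u) x‖ ^ p * ‖x‖ ^ (-a) =
      (k t ^ p)⁻¹ * ∫ x in Ω, χ |u x| ^ p * (‖fderiv ℝ u x‖ ^ p * ‖x‖ ^ (-a)) := by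
    rw [← integral_const_mul]
    refine integral_congr_ae (Filter.Eventually.of_forall fun x => ?_)
    have hd : fderiv ℝ (F ∘ u) x = ((χ (u x) - χ (-u x)) / k t) • fderiv ℝ u x :=
      ((hFd (u x)).comp_hasFDerivAt x
        (hu.differentiable (by simp) x).hasFDerivAt).fderiv
    simp only [hd, norm_smul, Real.norm_eq_abs, hFd']
    rw [Real.mul_rpow (div_nonneg (hχ0 _) hkt.le) (norm_nonneg _),
      Real.div_rpow (hχ0 _) hkt.le]
    ring
  rw [hint] at hle
  have hpos : 0 < k t ^ p := by positivity
  calc _ ≤ ((k t ^ p)⁻¹ * ∫ x in Ω, χ |u x| ^ p * (‖fderiv ℝ u x‖ ^ p * ‖x‖ ^ (-a))) * k t ^ p := by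
        gcongr
    _ = _ := by field_simp

end Capacity

section StepTest

/-- The energy of `u` below the level `t`. -/
def energyBelow {n : ℕ} (p a : ℝ) (u : EuclideanSpace ℝ (Fin n) → ℝ)
    (Ω : Set (EuclideanSpace ℝ (Fin n))) (t : ℝ) : ℝ :=
  ∫ x in Ω, {x | |u x| < t}.indicator (fun x => ‖fderiv ℝ u x‖ ^ p * ‖x‖ ^ (-a)) x

/-- A smooth approximation from below of a step function. -/
lemma exists_smooth_step {δ t η : ℝ} (hδ : 0 < δ) {k : ℕ} (hkt : k * δ ≤ t)
    {c : ℕ → ℝ} (hc : ∀ j, 0 ≤ c j) (hη : η ∈ Set.Ioo (0 : ℝ) 1) :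
    ∃ χ : ℝ → ℝ, ContDiff ℝ (⊤ : ℕ∞) χ ∧ (∀ s, 0 ≤ χ s) ∧ (∀ s ≤ 0, χ s = 0) ∧
      (1 - η) * (∑ j ∈ Finset.range k, c j * δ) ≤ ∫ s in (0 : ℝ)..t, χ s ∧
      ∀ s, χ s ≠ 0 → ∃ j < k, s ∈ Set.Ico (j * δ) ((j + 1) * δ) ∧ χ s ≤ c j := by
  have h1η : 0 < 1 - η := sub_pos.2 hη.2
  let b : ∀ j : ℕ, ContDiffBump ((j + 1 / 2) * δ) := fun j =>
    ⟨(1 - η) * (δ / 2), δ / 2, by positivity, by nlinarith [hη.1]⟩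
  have hb : ∀ j s, (b j) s ≠ 0 → s ∈ Set.Ioo (j * δ) ((j + 1) * δ) := by
    intro j s hs
    have : s ∈ Function.support (b j) := hs
    rw [(b j).support_eq, Real.ball_eq_Ioo] at this
    simp only [b] at this
    constructor <;> linarith [this.1, this.2]
  have hcont : ∀ j, Continuous (b j) := fun j => (b j).contDiff (n := 0) |>.continuous
  refine ⟨fun s => ∑ j ∈ Finset.range k, c j * b j s, ?_, ?_, ?_, ?_, ?_⟩
  · exact ContDiff.sum fun j _ => contDiff_const.mul (b j).contDiff
  · exact fun s => Finset.sum_nonneg fun j _ => mul_nonneg (hc j) (b j).nonneg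
  · intro s hs
    refine Finset.sum_eq_zero fun j _ => ?_
    by_contra hne
    have := (hb j s (right_ne_zero_of_mul hne)).1
    have : 0 ≤ j * δ := by positivity
    linarith
  · rw [intervalIntegral.integral_finsetSum (f := fun j s => c j * b j s)
      (fun j _ => (continuous_const.mul (hcont j)).intervalIntegrable _ _), Finset.mul_sum]
    refine Finset.sum_le_sum fun j hj => ?_
    rw [intervalIntegral.integral_const_mul, mul_left_comm]
    refine mul_le_mul_of_nonneg_left ?_ (hc j)
    have hjk : ((j : ℝ) + 1) ≤ k := by exact_mod_cast Finset.mem_range.1 hj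
    have hjt : (j + 1) * δ ≤ t := (mul_le_mul_of_nonneg_right hjk hδ.le).trans hkt
    have hj0 : 0 ≤ j * δ := by positivity
    have hlen : 0 < (1 - η) * (δ / 2) := by positivity
    have hlen' : (1 - η) * (δ / 2) ≤ δ / 2 := by nlinarith [hη.1]
    calc (1 - η) * δ = ∫ s in ((j + 1 / 2) * δ - (1 - η) * (δ / 2))..
          ((j + 1 / 2) * δ + (1 - η) * (δ / 2)), (1 : ℝ) := by
            rw [intervalIntegral.integral_const, smul_eq_mul]; ring
      _ = ∫ s in ((j + 1 / 2) * δ - (1 - η) * (δ / 2))..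
          ((j + 1 / 2) * δ + (1 - η) * (δ / 2)), b j s := by
            refine intervalIntegral.integral_congr fun s hs => ?_
            rw [Set.uIcc_of_le (by linarith), ← Real.closedBall_eq_Icc] at hs
            exact ((b j).one_of_mem_closedBall hs).symm
      _ ≤ _ := intervalIntegral.integral_mono_interval (by linarith) (by linarith) (by linarith)
            (Filter.Eventually.of_forall fun s => (b j).nonneg)
            ((hcont j).intervalIntegrable _ _)
  · intro s hs
    obtain ⟨j, hj, hne⟩ := Finset.exists_ne_zero_of_sum_ne_zero hs
    have hjs := hb j s (right_ne_zero_of_mul hne)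
    refine ⟨j, Finset.mem_range.1 hj, ⟨hjs.1.le, hjs.2⟩, ?_⟩
    beta_reduce
    rw [Finset.sum_eq_single_of_mem j hj]
    · exact mul_le_of_le_one_right (hc j) (b j).le_one
    · intro i _ hij
      by_contra hne'
      have his := hb i s (right_ne_zero_of_mul hne')
      have h1 : (i : ℝ) < j + 1 := lt_of_mul_lt_mul_right (his.1.trans hjs.2) hδ.le
      have h2 : (j : ℝ) < i + 1 := lt_of_mul_lt_mul_right (hjs.1.trans his.2) hδ.le
      norm_cast at h1 h2
      omega

variable {n : ℕ}

lemma measurableSet_abs_lt {u : EuclideanSpace ℝ (Fin n) → ℝ} (hu : Continuous u) (t : ℝ) :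
    MeasurableSet {x | |u x| < t} :=
  (isOpen_lt hu.abs continuous_const).measurableSet

lemma capPA_mul_sum_rpow_le {p a t δ : ℝ} (hp : 0 < p)
    {Ω : Set (EuclideanSpace ℝ (Fin n))}
    {u : EuclideanSpace ℝ (Fin n) → ℝ} (hu : ContDiff ℝ (⊤ : ℕ∞) u)
    (hcs : HasCompactSupport u) (hsupp : tsupport u ⊆ Ω)
    (hint : IntegrableOn (fun x => ‖fderiv ℝ u x‖ ^ p * ‖x‖ ^ (-a)) Ω)
    (hδ : 0 < δ) {k : ℕ} (hkt : k * δ ≤ t) {c : ℕ → ℝ} (hc : ∀ j, 0 ≤ c j) :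
    capPA p a {x ∈ Ω | t ≤ |u x|} Ω * (∑ j ∈ Finset.range k, c j * δ) ^ p ≤
      ∑ j ∈ Finset.range k, c j ^ p *
        (energyBelow p a u Ω ((j + 1) * δ) - energyBelow p a u Ω (j * δ)) := by
  set ρ : EuclideanSpace ℝ (Fin n) → ℝ := fun x => ‖fderiv ℝ u x‖ ^ p * ‖x‖ ^ (-a) with hρ
  have hρ0 : ∀ x, 0 ≤ ρ x := fun x => by positivity
  have hsum0 : 0 ≤ ∑ j ∈ Finset.range k, c j * δ :=
    Finset.sum_nonneg fun j _ => mul_nonneg (hc j) hδ.le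
  have ht : 0 ≤ t := le_trans (by positivity) hkt
  have hi : ∀ s, IntegrableOn ({x | |u x| < s}.indicator ρ) Ω := fun s =>
    hint.indicator (measurableSet_abs_lt hu.continuous s)
  have hsub : ∀ j : ℕ, IntegrableOn (fun x => c j ^ p *
      ({x | |u x| < (j + 1) * δ}.indicator ρ x - {x | |u x| < j * δ}.indicator ρ x)) Ω :=
    fun j => ((hi _).sub (hi _)).const_mul _
  have key : ∀ η ∈ Set.Ioo (0 : ℝ) 1, capPA p a {x ∈ Ω | t ≤ |u x|} Ω *
      ((1 - η) * ∑ j ∈ Finset.range k, c j * δ) ^ p ≤ ∑ j ∈ Finset.range k, c j ^ p *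
        (energyBelow p a u Ω ((j + 1) * δ) - energyBelow p a u Ω (j * δ)) := by
    intro η hη
    obtain ⟨χ, hχ, hχ0, hχneg, hχint, hχle⟩ := exists_smooth_step hδ hkt hc hη
    have h1η : 0 ≤ 1 - η := (sub_pos.2 hη.2).le
    calc _ ≤ capPA p a {x ∈ Ω | t ≤ |u x|} Ω * (∫ s in (0 : ℝ)..t, χ s) ^ p := by
          have := capPA_nonneg p a {x ∈ Ω | t ≤ |u x|} Ω
          gcongr
      _ ≤ ∫ x in Ω, χ |u x| ^ p * ρ x :=
          capPA_mul_integral_rpow_le hp ht hu hcs hsupp hχ hχ0 hχneg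
      _ ≤ ∫ x in Ω, ∑ j ∈ Finset.range k, c j ^ p *
            ({x | |u x| < (j + 1) * δ}.indicator ρ x - {x | |u x| < j * δ}.indicator ρ x) := by
          have hterm : ∀ (j : ℕ) x, 0 ≤
              {x | |u x| < (j + 1) * δ}.indicator ρ x - {x | |u x| < j * δ}.indicator ρ x := by
            intro j x
            refine sub_nonneg.2 (Set.indicator_le_indicator_of_subset (fun y hy => ?_) hρ0 x)
            have hy : |u y| < j * δ := hy
            exact hy.trans (by linarith)
          refine integral_mono_of_nonneg
            (Filter.Eventually.of_forall fun x => by have := hχ0 |u x|; positivity)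
            (integrable_finsetSum _ fun j _ => hsub j)
            (Filter.Eventually.of_forall fun x => ?_)
          have hnn : ∀ j ∈ Finset.range k, 0 ≤ c j ^ p * ({x | |u x| < (j + 1) * δ}.indicator ρ x -
              {x | |u x| < j * δ}.indicator ρ x) :=
            fun j _ => mul_nonneg (Real.rpow_nonneg (hc j) p) (hterm j x)
          by_cases h0 : χ |u x| = 0
          · simp only [h0, Real.zero_rpow hp.ne', zero_mul]
            exact Finset.sum_nonneg hnn
          · obtain ⟨j, hj, hmem, hle⟩ := hχle _ h0
            refine le_trans ?_ (Finset.single_le_sum hnn (Finset.mem_range.2 hj))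
            rw [Set.indicator_of_mem (show x ∈ {x | |u x| < (j + 1) * δ} from hmem.2),
              Set.indicator_of_notMem (show x ∉ {x | |u x| < j * δ} from not_lt.2 hmem.1), sub_zero]
            exact mul_le_mul_of_nonneg_right (Real.rpow_le_rpow (hχ0 _) hle hp.le) (hρ0 x)
      _ = _ := by
          rw [integral_finsetSum _ fun j _ => hsub j]
          refine Finset.sum_congr rfl fun j _ => ?_
          rw [integral_const_mul, integral_sub (hi _) (hi _)]
          rfl
  have hcont : ContinuousAt (fun η => capPA p a {x ∈ Ω | t ≤ |u x|} Ω *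
      ((1 - η) * ∑ j ∈ Finset.range k, c j * δ) ^ p) 0 :=
    continuousAt_const.mul (((continuousAt_const.sub continuousAt_id).mul
      continuousAt_const).rpow_const (Or.inr hp.le))
  refine le_of_tendsto (f := fun η => capPA p a {x ∈ Ω | t ≤ |u x|} Ω *
      ((1 - η) * ∑ j ∈ Finset.range k, c j * δ) ^ p) (x := nhdsWithin 0 (Set.Ioi 0)) ?_ ?_
  · simpa using hcont.tendsto.mono_left nhdsWithin_le_nhds
  · filter_upwards [Ioo_mem_nhdsGT zero_lt_one] with η hη using key η hη

end StepTest

section Nonintegrable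

variable {n : ℕ}

lemma not_integrableOn_weight {p a : ℝ} (hp : 0 < p) {Ω : Set (EuclideanSpace ℝ (Fin n))}
    {u : EuclideanSpace ℝ (Fin n) → ℝ} (hu : ContDiff ℝ (⊤ : ℕ∞) u) (hc : HasCompactSupport u)
    (hint : ¬ IntegrableOn (fun x => ‖fderiv ℝ u x‖ ^ p * ‖x‖ ^ (-a)) Ω) :
    ¬ IntegrableOn (fun x : EuclideanSpace ℝ (Fin n) => ‖x‖ ^ (-a)) (tsupport u) := by
  intro hw
  refine hint (Integrable.integrableOn ?_)
  rw [← integrableOn_iff_integrable_of_support_subset (s := tsupport u)]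
  · refine IntegrableOn.continuousOn_mul ?_ hw hc
    exact ((hu.continuous_fderiv (by simp)).norm.rpow_const fun _ => Or.inr hp.le).continuousOn
  · intro x hx
    refine support_fderiv_subset ℝ fun h0 => hx ?_
    simp [h0, Real.zero_rpow hp.ne']

/-- If the weight is not locally integrable, then a test function that is affine and non-constant
near the support has, by convention, vanishing energy. -/
lemma capPA_eq_zero_of_not_integrableOn {p a : ℝ} (hp : 0 < p) (hn : 1 ≤ n)
    {Ω K : Set (EuclideanSpace ℝ (Fin n))} (hΩ : IsOpen Ω)
    {u : EuclideanSpace ℝ (Fin n) → ℝ} (hu : ContDiff ℝ (⊤ : ℕ∞) u) (hc : HasCompactSupport u)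
    (hsupp : tsupport u ⊆ Ω) (hK : K ⊆ tsupport u)
    (hint : ¬ IntegrableOn (fun x => ‖fderiv ℝ u x‖ ^ p * ‖x‖ ^ (-a)) Ω) :
    capPA p a K Ω = 0 := by
  have hw := not_integrableOn_weight hp hu hc hint
  obtain ⟨L, hL, hSL, hLΩ⟩ := exists_compact_between hc hΩ hsupp
  obtain ⟨χ, hχ1, hχ0, -⟩ := exists_contMDiffMap_one_nhds_of_subset_interior
    (n := (⊤ : ℕ∞)) (modelWithCornersSelf ℝ (EuclideanSpace ℝ (Fin n))) (isClosed_tsupport u) hSL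
  obtain ⟨R, hR⟩ := hc.isBounded.exists_norm_le
  let ℓ : EuclideanSpace ℝ (Fin n) →L[ℝ] ℝ := EuclideanSpace.proj ⟨0, hn⟩
  have hℓ : 0 < ‖ℓ‖ := by
    rw [norm_pos_iff]
    intro h
    have := congrArg (fun f => f (EuclideanSpace.single ⟨0, hn⟩ 1)) h
    simp [ℓ] at this
  set v : EuclideanSpace ℝ (Fin n) → ℝ := fun x => χ x * (1 + ‖ℓ‖ * R + ℓ x) with hv
  have hvL : Function.support v ⊆ L := fun x hx => by
    by_contra hxL
    exact hx (by simp [hv, hχ0 x hxL])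
  have hvL' : tsupport v ⊆ L := closure_minimal hvL hL.isClosed
  have hvev : ∀ x ∈ tsupport u, v =ᶠ[nhds x] fun y => 1 + ‖ℓ‖ * R + ℓ y := by
    intro x hx
    filter_upwards [eventually_nhdsSet_iff_forall.1 hχ1 x hx] with y hy
    simp [hv, hy]
  refine le_antisymm ?_ (capPA_nonneg _ _ _ _)
  refine (capPA_le (v := v) ?_ (HasCompactSupport.of_support_subset_isCompact hL hvL)
    (hvL'.trans hLΩ) ?_).trans (le_of_eq (integral_undef ?_))
  · exact χ.contMDiff.contDiff.mul (contDiff_const.add ℓ.contDiff)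
  · intro x hx
    rw [(hvev x (hK hx)).eq_of_nhds]
    have h1 := ℓ.le_opNorm x
    have h2 := mul_le_mul_of_nonneg_left (hR x (hK hx)) hℓ.le
    rw [Real.norm_eq_abs] at h1
    linarith [neg_abs_le (ℓ x)]
  · intro hvint
    refine hw ?_
    have hS : IntegrableOn (fun x => (‖ℓ‖ ^ p)⁻¹ * (‖fderiv ℝ v x‖ ^ p * ‖x‖ ^ (-a)))
        (tsupport u) := Integrable.const_mul (IntegrableOn.mono_set hvint hsupp) _
    refine hS.congr_fun (fun x hx => ?_) (isClosed_tsupport u).measurableSet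
    have hvx : fderiv ℝ v x = ℓ := by
      rw [(hvev x hx).fderiv_eq, fderiv_const_add, ℓ.fderiv]
    have : 0 < ‖ℓ‖ ^ p := by positivity
    beta_reduce
    rw [hvx]
    field_simp

end Nonintegrable

section StepProfile

/-- The data of a decreasing profile `C` controlled by the increments of an increasing profile `S`
through all step functions. -/
structure StepBound (p U E : ℝ) (C S : ℝ → ℝ) : Prop where
  nonneg : ∀ t, 0 ≤ C t
  eq_zero : ∀ t, U < t → C t = 0
  mono : Monotone S
  zero : S 0 = 0
  eq_top : ∀ t, U < t → S t = E
  step : ∀ (δ t : ℝ) (k : ℕ) (c : ℕ → ℝ), 0 < δ → k * δ ≤ t → (∀ j, 0 ≤ c j) →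
    C t * (∑ j ∈ Finset.range k, c j * δ) ^ p ≤
      ∑ j ∈ Finset.range k, c j ^ p * (S ((j + 1) * δ) - S (j * δ))

lemma StepBound.le_top {p U E : ℝ} {C S : ℝ → ℝ} (h : StepBound p U E C S) (t : ℝ) : S t ≤ E := by
  rw [← h.eq_top (max t U + 1) (by linarith [le_max_right t U])]
  exact h.mono (by linarith [le_max_left t U])

lemma StepBound.integral_Ioi {p U E q r T : ℝ} {C S : ℝ → ℝ} (h : StepBound p U E C S)
    (hT : 0 ≤ T) (hUT : U ≤ T) (hr : r ≠ 0) :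
    ∫ t in Set.Ioi (0 : ℝ), t ^ (q - 1) * C t ^ r = ∫ t in (0 : ℝ)..T, t ^ (q - 1) * C t ^ r := by
  rw [intervalIntegral.integral_of_le hT]
  refine setIntegral_eq_of_subset_of_forall_sdiff_eq_zero measurableSet_Ioi
    Set.Ioc_subset_Ioi_self fun t ht => ?_
  have : T < t := not_le.1 fun hle => ht.2 ⟨ht.1, hle⟩
  rw [h.eq_zero t (hUT.trans_lt this), Real.zero_rpow hr, mul_zero]

/-- The limiting case `p = 1`. -/
lemma StepBound.integral_le_of_one {U E q : ℝ} {C S : ℝ → ℝ} (h : StepBound 1 U E C S)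
    (hq : 1 < q) : q * ∫ t in Set.Ioi (0 : ℝ), t ^ (q - 1) * C t ^ q ≤ E ^ q := by
  have hE : 0 ≤ E := h.zero ▸ h.le_top 0
  by_cases hint : IntegrableOn (fun t => t ^ (q - 1) * C t ^ q) (Set.Ioi 0)
  swap
  · rw [integral_undef hint, mul_zero]; positivity
  set T := max U 0 with hT
  have hT0 : 0 ≤ T := le_max_right _ _
  rw [h.integral_Ioi hT0 (le_max_left _ _) (by linarith), ← intervalIntegral.integral_const_mul]
  have hSnn : ∀ t, 0 ≤ t → 0 ≤ S t := fun t ht => h.zero ▸ h.mono ht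
  have hmono : MonotoneOn (fun t => S t ^ q) (Set.uIcc 0 T) := by
    rw [Set.uIcc_of_le hT0]
    exact fun s hs t _ hst => Real.rpow_le_rpow (hSnn s hs.1) (h.mono hst) (by linarith)
  have hmem := hmono.intervalIntegral_deriv_mem_uIcc
  have hle : S 0 ^ q ≤ S T ^ q := hmono Set.left_mem_uIcc Set.right_mem_uIcc hT0
  rw [Set.uIcc_of_le (by linarith), h.zero, Real.zero_rpow (by linarith), sub_zero] at hmem
  refine le_trans ?_ (hmem.2.trans (Real.rpow_le_rpow (hSnn T hT0) (h.le_top T) (by linarith)))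
  refine intervalIntegral.integral_mono_ae_restrict hT0 ?_ hmono.intervalIntegrable_deriv ?_
  · rw [intervalIntegrable_iff_integrableOn_Ioc_of_le hT0]
    exact (hint.mono_set Set.Ioc_subset_Ioi_self).const_mul q
  filter_upwards [ae_restrict_of_ae h.mono.ae_differentiableAt,
    ae_restrict_of_ae (Measure.ae_ne volume (0 : ℝ)), ae_restrict_mem measurableSet_Icc]
    with t hd hne ht
  have ht0 : 0 < t := lt_of_le_of_ne ht.1 hne.symm
  have h1 : C t * t ≤ S t := by
    have := h.step t t 1 (fun _ => 1) ht0 (by simp) (fun _ => zero_le_one)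
    simpa [h.zero] using this
  have h2 : C t ≤ deriv S t := by
    have hlim := (hasDerivAt_iff_tendsto_slope.1 hd.hasDerivAt)
    have hseq : Filter.Tendsto (fun k : ℕ => t - t / (k + 1)) Filter.atTop
        (nhdsWithin t {t}ᶜ) := by
      refine tendsto_nhdsWithin_iff.2 ⟨?_, Filter.Eventually.of_forall fun k => ?_⟩
      · have := (tendsto_one_div_add_atTop_nhds_zero_nat (𝕜 := ℝ)).const_mul t
        simpa [div_eq_mul_inv] using this.const_sub t
      · have : 0 < t / ((k : ℝ) + 1) := by positivity
        simp only [Set.mem_compl_iff, Set.mem_singleton_iff]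
        linarith
    refine ge_of_tendsto' (hlim.comp hseq) fun k => ?_
    have hk : (0 : ℝ) < k + 1 := by positivity
    have hδ : 0 < t / ((k : ℝ) + 1) := by positivity
    have := h.step (t / (k + 1)) t (k + 1) (fun j => if j = k then 1 else 0) hδ
      (by push_cast; rw [mul_div_cancel₀ _ hk.ne']) (fun j => by split_ifs <;> simp)
    have e1 : ((k : ℝ) + 1) * (t / (k + 1)) = t := by field_simp
    have e2 : (k : ℝ) * (t / (k + 1)) = t - t / (k + 1) := by field_simp; ring
    rw [Finset.sum_range_succ, Finset.sum_range_succ, Finset.sum_eq_zero, Finset.sum_eq_zero] at this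
    · simp only [if_true, Real.rpow_one, zero_add, one_mul, e1, e2] at this
      rw [Function.comp_apply, slope_def_field, show t - t / (k + 1) - t = -(t / ((k : ℝ) + 1)) by ring,
        div_neg, ← neg_div, neg_sub, le_div_iff₀ hδ]
      exact this
    · intro j hj
      simp [(Finset.mem_range.1 hj).ne]
    · intro j hj
      simp [(Finset.mem_range.1 hj).ne]
  have hder : deriv (fun t => S t ^ q) t = deriv S t * q * S t ^ (q - 1) :=
    (hd.hasDerivAt.rpow_const (Or.inr hq.le)).deriv
  rw [hder]
  have hC := h.nonneg t
  calc q * (t ^ (q - 1) * C t ^ q) = C t * q * (C t * t) ^ (q - 1) := by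
        rw [Real.mul_rpow hC ht0.le]
        have : C t ^ q = C t * C t ^ (q - 1) := by
          rw [← Real.rpow_one_add' hC (by linarith)]; congr 1; ring
        rw [this]; ring
    _ ≤ _ := by
        have : 0 ≤ C t * t := by positivity
        have : 0 ≤ deriv S t := hC.trans h2
        gcongr

end StepProfile

section StepFunction

lemma measurable_stepFunction (δ : ℝ) (c : ℕ → ℝ) : Measurable fun s : ℝ => c ⌊s / δ⌋₊ :=
  (measurable_from_nat (f := c)).comp (Nat.measurable_floor.comp (measurable_id.div_const δ))

lemma intervalIntegrable_stepFunction {δ : ℝ} (hδ : 0 < δ) (c : ℕ → ℝ) (a b : ℝ) :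
    IntervalIntegrable (fun s : ℝ => c ⌊s / δ⌋₊) volume a b := by
  rw [intervalIntegrable_iff]
  refine Measure.integrableOn_of_bounded (by simp [Set.uIoc])
    (measurable_stepFunction δ c).aestronglyMeasurable
    (M := ∑ j ∈ Finset.range (⌊max a b / δ⌋₊ + 1), ‖c j‖) ?_
  filter_upwards [ae_restrict_mem measurableSet_uIoc] with s hs
  refine Finset.single_le_sum (f := fun j => ‖c j‖) (fun j _ => norm_nonneg _)
    (Finset.mem_range.2 (Nat.lt_succ_of_le (Nat.floor_le_floor ?_)))
  have : s ≤ max a b := hs.2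
  gcongr

lemma hasDerivWithinAt_integral_stepFunction {δ : ℝ} (hδ : 0 < δ) (c : ℕ → ℝ) {t : ℝ}
    (ht : 0 ≤ t) :
    HasDerivWithinAt (fun t => ∫ s in (0 : ℝ)..t, c ⌊s / δ⌋₊) (c ⌊t / δ⌋₊) (Set.Ici t) t := by
  refine intervalIntegral.integral_hasDerivWithinAt_right (t := Set.Ioi t)
    (f := fun s : ℝ => c ⌊s / δ⌋₊)
    (intervalIntegrable_stepFunction hδ c 0 t)
    (measurable_stepFunction δ c).stronglyMeasurable.stronglyMeasurableAtFilter ?_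
  have hlt : t < (⌊t / δ⌋₊ + 1) * δ := by
    rw [← div_lt_iff₀ hδ]; exact Nat.lt_floor_add_one _
  refine (continuousWithinAt_const (b := c ⌊t / δ⌋₊)).congr_of_eventuallyEq ?_ rfl
  filter_upwards [Ioo_mem_nhdsGT hlt] with s hs
  congr 1
  rw [Nat.floor_eq_iff (div_nonneg (ht.trans hs.1.le) hδ.le)]
  refine ⟨(Nat.floor_le (by positivity)).trans (by have := hs.1.le; gcongr), ?_⟩
  rw [div_lt_iff₀ hδ]
  exact hs.2

lemma integral_stepFunction {δ : ℝ} (hδ : 0 < δ) (c : ℕ → ℝ) (k : ℕ) :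
    ∫ s in (0 : ℝ)..k * δ, c ⌊s / δ⌋₊ = ∑ j ∈ Finset.range k, c j * δ := by
  have := intervalIntegral.sum_integral_adjacent_intervals (a := fun j : ℕ => (j : ℝ) * δ)
    (f := fun s : ℝ => c ⌊s / δ⌋₊) (μ := volume) (n := k)
    (fun j _ => intervalIntegrable_stepFunction hδ c _ _)
  simp only [Nat.cast_zero, zero_mul] at this
  rw [← this]
  refine Finset.sum_congr rfl fun j _ => ?_
  have hle : (j : ℝ) * δ ≤ ((j + 1 : ℕ) : ℝ) * δ := by push_cast; nlinarith
  rw [intervalIntegral.integral_congr_Ioo_of_le (g := fun _ => c j) hle,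
    intervalIntegral.integral_const, smul_eq_mul]
  · push_cast; ring
  · intro s hs
    have hs0 : 0 ≤ s := le_trans (by positivity) hs.1.le
    have : ⌊s / δ⌋₊ = j := by
      rw [Nat.floor_eq_iff (by positivity), le_div_iff₀ hδ, div_lt_iff₀ hδ]
      exact ⟨hs.1.le, by simpa using hs.2⟩
    simp only [this]

end StepFunction

section Discretization

lemma StepBound.le_rpow {p U E δ ε t : ℝ} {C S : ℝ → ℝ} (h : StepBound p U E C S) (hp : 1 < p)
    (hδ : 0 < δ) (hε : 0 < ε) {φ : ℕ → ℝ}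
    (hφ : ∀ j : ℕ, φ j = ((S ((j + 1) * δ) - S (j * δ)) / δ + ε) ^ (-(1 / (p - 1))))
    (ht : δ < t) :
    C t ≤ (∫ s in (0 : ℝ)..t - δ, φ ⌊s / δ⌋₊) ^ (1 - p) := by
  have hp1 : 0 < p - 1 := by linarith
  have he : ∀ j : ℕ, 0 ≤ S ((j + 1) * δ) - S (j * δ) := fun j =>
    sub_nonneg.2 (h.mono (by nlinarith))
  have hφ0 : ∀ j, 0 < φ j := fun j => by
    rw [hφ]; have := he j; positivity
  have ht0 : 0 < t := hδ.trans ht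
  set k := ⌊t / δ⌋₊ with hk
  have hkt : k * δ ≤ t := by
    rw [← le_div_iff₀ hδ]; exact Nat.floor_le (by positivity)
  have htk : t - δ ≤ k * δ := by
    have : t < (k + 1) * δ := by rw [← div_lt_iff₀ hδ]; exact Nat.lt_floor_add_one _
    linarith
  have hpos : 0 < ∫ s in (0 : ℝ)..t - δ, φ ⌊s / δ⌋₊ :=
    intervalIntegral.intervalIntegral_pos_of_pos (intervalIntegrable_stepFunction hδ φ _ _)
      (fun s => hφ0 _) (by linarith)
  have hmono : ∫ s in (0 : ℝ)..t - δ, φ ⌊s / δ⌋₊ ≤ ∑ j ∈ Finset.range k, φ j * δ := by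
    rw [← integral_stepFunction hδ]
    exact intervalIntegral.integral_mono_interval le_rfl (by linarith) htk
      (Filter.Eventually.of_forall fun s => (hφ0 _).le) (intervalIntegrable_stepFunction hδ φ _ _)
  have hsum := hpos.trans_le hmono
  have hstep := h.step δ t k φ hδ hkt fun j => (hφ0 j).le
  have hle : ∑ j ∈ Finset.range k, φ j ^ p * (S ((j + 1) * δ) - S (j * δ)) ≤
      ∑ j ∈ Finset.range k, φ j * δ := by
    refine Finset.sum_le_sum fun j _ => ?_
    have hd : 0 < (S ((j + 1) * δ) - S (j * δ)) / δ + ε := by have := he j; positivity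
    have h1 : φ j ^ (1 - p) = (S ((j + 1) * δ) - S (j * δ)) / δ + ε := by
      rw [hφ, ← Real.rpow_mul hd.le, show -(1 / (p - 1)) * (1 - p) = 1 by field_simp; ring,
        Real.rpow_one]
    have h2 : φ j ^ p * φ j ^ (1 - p) = φ j := by
      rw [← Real.rpow_add (hφ0 j)]; simp
    calc φ j ^ p * (S ((j + 1) * δ) - S (j * δ)) ≤ φ j ^ p * (φ j ^ (1 - p) * δ) := by
          have := hφ0 j
          have : S ((j + 1) * δ) - S (j * δ) ≤ φ j ^ (1 - p) * δ := by
            rw [h1, add_mul (_ / δ), div_mul_cancel₀ _ hδ.ne']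
            have : 0 < ε * δ := by positivity
            linarith
          gcongr
      _ = φ j * δ := by rw [← mul_assoc, h2]
  calc C t ≤ (∑ j ∈ Finset.range k, φ j * δ) ^ (1 - p) := by
        rw [Real.rpow_sub hsum, Real.rpow_one, le_div_iff₀ (by positivity)]
        exact hstep.trans hle
    _ ≤ _ := Real.rpow_le_rpow_of_nonpos hpos hmono (by linarith)

lemma StepBound.integral_le_of_step {p U E q δ ε δ₀ : ℝ} {C S : ℝ → ℝ} (h : StepBound p U E C S)
    (hp : 1 < p) (hpq : p < q) (hδ : 0 < δ) (hε : 0 < ε) {n : ℕ} (hn : U < n * δ)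
    (hδ₀ : δ < δ₀) (hδ₀n : δ₀ ≤ (n + 1) * δ)
    (hint : IntegrableOn (fun t => t ^ (q - 1) * C t ^ (q / p)) (Set.Ioi 0)) :
    q * ∫ t in δ₀..(n + 1) * δ, t ^ (q - 1) * C t ^ (q / p) ≤ (δ₀ / (δ₀ - δ)) ^ (q - 1) *
      (incBeta (q * (p - 1) / (q - p)) (q / (q - p)) 1 ^ (1 - q / p) *
          (E + ε * ((n + 1) * δ)) ^ (q / p) +
        ((n + 1) * δ) ^ q * (δ ^ (-(q * ((p - 1) / p))) * ε ^ (q / p))) := by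
  have hp0 : 0 < p := by linarith
  have hp1 : 0 < p - 1 := by linarith
  have hq0 : 0 < q := by linarith
  have hqp : 0 < q - p := by linarith
  have hdq : q * ((p - 1) / p) < q - 1 := by
    rw [← mul_div_assoc, div_lt_iff₀ hp0]; nlinarith
  set d := q * ((p - 1) / p) with hd
  have hd0 : 0 < d := by positivity
  set T := (n + 1) * δ with hT
  have hT0 : 0 < T := by positivity
  have hT' : ((n + 1 : ℕ) : ℝ) * δ = T := by push_cast; rfl
  have he : ∀ j : ℕ, 0 ≤ S ((j + 1) * δ) - S (j * δ) := fun j =>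
    sub_nonneg.2 (h.mono (by nlinarith))
  have heE : ∀ j : ℕ, S ((j + 1) * δ) - S (j * δ) ≤ E := fun j => by
    have h1 := h.le_top ((j + 1) * δ)
    have h2 : 0 ≤ S (j * δ) := h.zero ▸ h.mono (by positivity)
    linarith
  have hE : 0 ≤ E := (he 0).trans (heE 0)
  set D : ℕ → ℝ := fun j => (S ((j + 1) * δ) - S (j * δ)) / δ + ε with hD
  have hD0 : ∀ j, 0 < D j := fun j => by have := he j; positivity
  set φ : ℕ → ℝ := fun j => D j ^ (-(1 / (p - 1))) with hφ
  have hφ0 : ∀ j, 0 < φ j := fun j => by have := hD0 j; positivity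
  have hφD : ∀ j, φ j ^ (1 - p) = D j := fun j => by
    rw [hφ, ← Real.rpow_mul (hD0 j).le, show -(1 / (p - 1)) * (1 - p) = 1 by field_simp; ring,
        Real.rpow_one]
  set ψ : ℝ → ℝ := fun t => ∫ s in (0 : ℝ)..t, φ ⌊s / δ⌋₊ with hψ
  set G : ℝ → ℝ := fun t => ∫ s in (0 : ℝ)..t, D ⌊s / δ⌋₊ with hG
  have hψc : Continuous ψ := intervalIntegral.continuous_primitive
    (fun a b => intervalIntegrable_stepFunction hδ φ a b) 0
  have hGc : Continuous G := intervalIntegral.continuous_primitive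
    (fun a b => intervalIntegrable_stepFunction hδ D a b) 0
  set c := (E / δ + ε) ^ (-(1 / (p - 1))) with hc
  have hc0 : 0 < c := by positivity
  have hlow : ∀ t ∈ Set.Icc 0 T, c * t ≤ ψ t := by
    intro t ht
    have := intervalIntegral.integral_mono_on (f := fun _ => c) (μ := volume) ht.1
      intervalIntegrable_const (intervalIntegrable_stepFunction hδ φ 0 t) (fun s _ =>
        Real.rpow_le_rpow_of_nonpos (hD0 ⌊s / δ⌋₊) (y := E / δ + ε) (by
          have := heE ⌊s / δ⌋₊
          simp only [hD]
          gcongr) (by have : 0 < 1 / (p - 1) := by positivity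
                      linarith))
    rw [intervalIntegral.integral_const, smul_eq_mul, sub_zero, mul_comm] at this
    exact this
  have hGT : G T = E + ε * T := by
    have h1 : G T = ∑ j ∈ Finset.range (n + 1), D j * δ := by
      rw [← integral_stepFunction hδ D, hT']
    have h2 : ∀ j : ℕ, D j * δ = (S ((j + 1 : ℕ) * δ) - S (j * δ)) + ε * δ := by
      intro j; simp only [hD]; push_cast; field_simp
    simp only [h1, h2, Finset.sum_add_distrib]
    rw [Finset.sum_range_sub (fun j : ℕ => S (j * δ)), hT', Nat.cast_zero, zero_mul, h.zero,
      h.eq_top T (by rw [hT]; nlinarith)]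
    simp [hT]; ring
  have hG0 : G 0 = 0 := by simp [hG]
  have hbliss := bliss_inequality (ψ := ψ) (φ := fun s => φ ⌊s / δ⌋₊) (G := G) hp hpq hT0 hc0
    hψc.continuousOn hlow
    (fun t ht => hasDerivWithinAt_integral_stepFunction hδ φ ht.1.le) (fun t _ => hφ0 _)
    hGc.continuousOn
    (fun t ht => by
      rw [hφD]; exact hasDerivWithinAt_integral_stepFunction hδ D ht.1.le)
    (by rw [hG0, hGT]; positivity)
  rw [← hd, hG0, sub_zero, hGT] at hbliss
  have hψT : ψ T ^ (-d) ≤ δ ^ (-d) * ε ^ (q / p) := by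
    have h1 : δ * ε ^ (-(1 / (p - 1))) ≤ ψ T := by
      have h2 : ψ T = ∑ j ∈ Finset.range (n + 1), φ j * δ := by
        rw [← integral_stepFunction hδ φ, hT']
      have h3 : D n = ε := by
        simp only [hD]
        rw [h.eq_top _ hn, h.eq_top _ (hn.trans (by nlinarith)), sub_self, zero_div, zero_add]
      have h4 := Finset.single_le_sum (f := fun j => φ j * δ)
        (fun j _ => (mul_pos (hφ0 j) hδ).le) (Finset.self_mem_range_succ n)
      rw [h2]
      refine le_trans (le_of_eq ?_) h4
      simp only [hφ, h3]; ring
    refine (Real.rpow_le_rpow_of_nonpos (by positivity) h1 (by linarith)).trans (le_of_eq ?_)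
    rw [Real.mul_rpow hδ.le (by positivity), ← Real.rpow_mul hε.le]
    congr 2
    rw [hd]; field_simp
  set m : ℝ → ℝ := fun t => t ^ (q - 1) * ψ t ^ (-d) with hm
  have hmc : ContinuousOn m (Set.Icc 0 T) :=
    continuousOn_rpow_mul_rpow_neg hc0 hψc.continuousOn hlow hd0.le hdq
  have hmi : IntervalIntegrable m volume 0 T :=
    ContinuousOn.intervalIntegrable (by rwa [Set.uIcc_of_le hT0.le])
  have hψnn : ∀ t, 0 ≤ t → 0 ≤ ψ t := fun t ht =>
    intervalIntegral.integral_nonneg ht fun s _ => (hφ0 _).le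
  have hR : 0 < δ₀ - δ := by linarith
  have hδ₀0 : 0 < δ₀ := by linarith
  set R := δ₀ / (δ₀ - δ) with hRdef
  have hR0 : 0 < R := by positivity
  have hmain : ∫ t in δ₀..T, t ^ (q - 1) * C t ^ (q / p) ≤
      R ^ (q - 1) * ∫ t in (0 : ℝ)..T, m t := by
    calc ∫ t in δ₀..T, t ^ (q - 1) * C t ^ (q / p)
        ≤ ∫ t in δ₀..T, R ^ (q - 1) * m (t - δ) := by
          refine intervalIntegral.integral_mono_on hδ₀n ?_ ?_ ?_
          · rw [intervalIntegrable_iff_integrableOn_Ioc_of_le hδ₀n]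
            exact hint.mono_set fun t ht => hδ₀0.trans ht.1
          · refine ContinuousOn.intervalIntegrable ?_
            rw [Set.uIcc_of_le hδ₀n]
            exact continuousOn_const.mul (hmc.comp (by fun_prop)
              fun t ht => ⟨by linarith [ht.1], by linarith [ht.2]⟩)
          · intro t ht
            have htδ : δ < t := hδ₀.trans_le ht.1
            have h1 := h.le_rpow hp hδ hε (φ := φ) (fun j => rfl) htδ
            have h2 : C t ^ (q / p) ≤ ψ (t - δ) ^ (-d) := by
              refine (Real.rpow_le_rpow (h.nonneg t) h1 (by positivity)).trans (le_of_eq ?_)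
              rw [← Real.rpow_mul (hψnn _ (by linarith))]
              congr 1
              rw [hd]; field_simp; ring
            have h3 : t ^ (q - 1) ≤ R ^ (q - 1) * (t - δ) ^ (q - 1) := by
              rw [← Real.mul_rpow hR0.le (by linarith)]
              refine Real.rpow_le_rpow (by linarith) ?_ (by linarith)
              rw [hRdef, div_mul_eq_mul_div, le_div_iff₀ hR]
              nlinarith [ht.1]
            have h4 : 0 ≤ C t ^ (q / p) := Real.rpow_nonneg (h.nonneg t) _
            have h5 : 0 < t - δ := by linarith
            calc t ^ (q - 1) * C t ^ (q / p)
                ≤ (R ^ (q - 1) * (t - δ) ^ (q - 1)) * ψ (t - δ) ^ (-d) := by gcongr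
              _ = _ := by simp only [hm]; ring
      _ = R ^ (q - 1) * ∫ t in δ₀ - δ..T - δ, m t := by
          rw [intervalIntegral.integral_const_mul, intervalIntegral.integral_comp_sub_right m]
      _ ≤ _ := by
          refine mul_le_mul_of_nonneg_left ?_ (by positivity)
          refine intervalIntegral.integral_mono_interval hR.le (by linarith) (by linarith) ?_ hmi
          filter_upwards [ae_restrict_mem measurableSet_Ioc] with t ht
          exact mul_nonneg (Real.rpow_nonneg ht.1.le _) (Real.rpow_nonneg (hψnn t ht.1.le) _)
  have hTq : T ^ q * ψ T ^ (-d) ≤ T ^ q * (δ ^ (-d) * ε ^ (q / p)) := by gcongr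
  calc q * ∫ t in δ₀..T, t ^ (q - 1) * C t ^ (q / p)
      ≤ q * (R ^ (q - 1) * ∫ t in (0 : ℝ)..T, m t) := by gcongr
    _ = R ^ (q - 1) * (q * ∫ t in (0 : ℝ)..T, m t) := by ring
    _ ≤ _ := by
        refine mul_le_mul_of_nonneg_left ?_ (by positivity)
        linarith

/-- The sharp bound for a decreasing profile controlled through all step functions. -/
lemma StepBound.integral_le {p U E q : ℝ} {C S : ℝ → ℝ} (h : StepBound p U E C S)
    (hp : 1 < p) (hpq : p < q) :
    q * ∫ t in Set.Ioi (0 : ℝ), t ^ (q - 1) * C t ^ (q / p) ≤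
      incBeta (q * (p - 1) / (q - p)) (q / (q - p)) 1 ^ (1 - q / p) * E ^ (q / p) := by
  have hp0 : 0 < p := by linarith
  have hp1 : 0 < p - 1 := by linarith
  have hq0 : 0 < q := by linarith
  have hqp : 0 < q - p := by linarith
  have hE : 0 ≤ E := h.zero ▸ h.le_top 0
  have hr : 0 < q / p := by positivity
  have hB := incBeta_one_pos (α := q * (p - 1) / (q - p)) (β := q / (q - p)) (by positivity)
    (by rw [le_div_iff₀ hqp]; linarith)
  set B := incBeta (q * (p - 1) / (q - p)) (q / (q - p)) 1 ^ (1 - q / p) with hBdef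
  by_cases hint : IntegrableOn (fun t => t ^ (q - 1) * C t ^ (q / p)) (Set.Ioi 0)
  swap
  · rw [integral_undef hint, mul_zero]; positivity
  set T := 2 * (|U| + 1) with hT
  have hT0 : 0 < T := by positivity
  have hUT : U < T / 2 := by rw [hT]; linarith [le_abs_self U]
  rw [h.integral_Ioi hT0.le (by linarith) hr.ne']
  set f : ℝ → ℝ := fun t => t ^ (q - 1) * C t ^ (q / p) with hf
  have hδ : Filter.Tendsto (fun n : ℕ => T / ((n : ℝ) + 1)) Filter.atTop (nhds 0) := by
    have := (tendsto_one_div_add_atTop_nhds_zero_nat (𝕜 := ℝ)).const_mul T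
    simpa [div_eq_mul_inv] using this
  have hε : ∀ (n : ℕ) (δ₀ : ℝ), 1 ≤ n → T / ((n : ℝ) + 1) < δ₀ → δ₀ ≤ T →
      q * ∫ t in δ₀..T, f t ≤ (δ₀ / (δ₀ - T / ((n : ℝ) + 1))) ^ (q - 1) * (B * E ^ (q / p)) := by
    intro n δ₀ hn hδ₀ hδ₀T
    have hn1 : (0 : ℝ) < n + 1 := by positivity
    have hnT : ((n : ℝ) + 1) * (T / (n + 1)) = T := mul_div_cancel₀ _ hn1.ne'
    have hUn : U < n * (T / ((n : ℝ) + 1)) := by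
      refine hUT.trans_le ?_
      have : (1 : ℝ) ≤ n := by exact_mod_cast hn
      rw [← mul_div_assoc, div_le_div_iff₀ two_pos hn1]
      nlinarith
    have hcont : ContinuousAt (fun ε : ℝ => (δ₀ / (δ₀ - T / ((n : ℝ) + 1))) ^ (q - 1) *
        (B * (E + ε * T) ^ (q / p) +
          T ^ q * ((T / ((n : ℝ) + 1)) ^ (-(q * ((p - 1) / p))) * ε ^ (q / p)))) 0 := by
      have h1 : ContinuousAt (fun ε : ℝ => (E + ε * T) ^ (q / p)) 0 :=
        ContinuousAt.rpow_const (by fun_prop) (Or.inr hr.le)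
      have h2 : ContinuousAt (fun ε : ℝ => ε ^ (q / p)) 0 :=
        ContinuousAt.rpow_const continuousAt_id (Or.inr hr.le)
      fun_prop
    have hlim := hcont.tendsto.mono_left (nhdsWithin_le_nhds (s := Set.Ioi 0))
    simp only [zero_mul, add_zero, Real.zero_rpow hr.ne', mul_zero] at hlim
    refine ge_of_tendsto hlim ?_
    filter_upwards [self_mem_nhdsWithin] with ε hε
    have := h.integral_le_of_step hp hpq (δ := T / ((n : ℝ) + 1)) (by positivity) hε hUn hδ₀
      (by rwa [hnT]) hint
    rwa [hnT] at this
  have hδ₀ : ∀ δ₀ ∈ Set.Ioc 0 T, q * ∫ t in δ₀..T, f t ≤ B * E ^ (q / p) := by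
    intro δ₀ hδ₀
    have hlim : Filter.Tendsto (fun n : ℕ => (δ₀ / (δ₀ - T / ((n : ℝ) + 1))) ^ (q - 1) *
        (B * E ^ (q / p))) Filter.atTop (nhds ((δ₀ / (δ₀ - 0)) ^ (q - 1) * (B * E ^ (q / p)))) := by
      refine Filter.Tendsto.mul_const _ (Filter.Tendsto.rpow_const ?_ (Or.inr (by linarith)))
      exact tendsto_const_nhds.div (hδ.const_sub δ₀) (by simpa using hδ₀.1.ne')
    rw [sub_zero, div_self hδ₀.1.ne', Real.one_rpow, one_mul] at hlim
    refine ge_of_tendsto hlim ?_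
    filter_upwards [hδ.eventually_lt_const hδ₀.1, Filter.eventually_ge_atTop 1] with n h1 h2
    exact hε n δ₀ h2 h1 hδ₀.2
  have hcont : ContinuousOn (fun x => ∫ t in x..T, f t) (Set.Icc 0 T) := by
    have := intervalIntegral.continuousOn_primitive_interval_left (μ := volume) (f := f)
      (a := 0) (b := T) (by
        rw [Set.uIcc_of_le hT0.le, integrableOn_Icc_iff_integrableOn_Ioc]
        exact hint.mono_set Set.Ioc_subset_Ioi_self)
    rwa [Set.uIcc_of_le hT0.le] at this
  have hlim := ((hcont 0 ⟨le_rfl, hT0.le⟩).mono (Set.Ioc_subset_Icc_self)).const_mul q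
  have hne : (nhdsWithin (0 : ℝ) (Set.Ioc 0 T)).NeBot := by
    rw [nhdsWithin_Ioc_eq_nhdsGT hT0]; infer_instance
  refine le_of_tendsto hlim.tendsto ?_
  filter_upwards [self_mem_nhdsWithin] with x hx using hδ₀ x hx

end Discretization

section Main

variable {n : ℕ}

lemma energyBelow_zero (p a : ℝ) (u : EuclideanSpace ℝ (Fin n) → ℝ)
    (Ω : Set (EuclideanSpace ℝ (Fin n))) : energyBelow p a u Ω 0 = 0 := by
  have : {x | |u x| < 0} = ∅ := by
    ext x; simp
  simp [energyBelow, this]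

lemma monotone_energyBelow {p a : ℝ} {u : EuclideanSpace ℝ (Fin n) → ℝ} (hu : Continuous u)
    {Ω : Set (EuclideanSpace ℝ (Fin n))}
    (hint : IntegrableOn (fun x => ‖fderiv ℝ u x‖ ^ p * ‖x‖ ^ (-a)) Ω) :
    Monotone (energyBelow p a u Ω) := by
  intro s t hst
  refine integral_mono (hint.indicator (measurableSet_abs_lt hu s))
    (hint.indicator (measurableSet_abs_lt hu t)) fun x => ?_
  exact Set.indicator_le_indicator_of_subset (fun y hy => lt_of_lt_of_le hy hst)
    (fun y => by positivity) x

lemma exists_stepBound_capPA {p a : ℝ} (hp : 0 < p) {Ω : Set (EuclideanSpace ℝ (Fin n))}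
    {u : EuclideanSpace ℝ (Fin n) → ℝ} (hu : ContDiff ℝ (⊤ : ℕ∞) u)
    (hc : HasCompactSupport u) (hsupp : tsupport u ⊆ Ω)
    (hint : IntegrableOn (fun x => ‖fderiv ℝ u x‖ ^ p * ‖x‖ ^ (-a)) Ω) :
    ∃ U, StepBound p U (∫ x in Ω, ‖fderiv ℝ u x‖ ^ p * ‖x‖ ^ (-a))
      (fun t => capPA p a {x ∈ Ω | t ≤ |u x|} Ω) (energyBelow p a u Ω) := by
  obtain ⟨U, hU⟩ := hu.continuous.bounded_above_of_compact_support hc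
  refine ⟨U, fun t => capPA_nonneg _ _ _ _, fun t ht => ?_, monotone_energyBelow hu.continuous hint,
    energyBelow_zero p a u Ω, fun t ht => ?_, fun δ t k c hδ hkt hc0 =>
      capPA_mul_sum_rpow_le hp hu hc hsupp hint hδ hkt hc0⟩
  · have : {x ∈ Ω | t ≤ |u x|} = ∅ :=
      Set.eq_empty_of_forall_notMem fun x hx => absurd ((hx.2.trans (hU x)).trans_lt ht) (lt_irrefl _)
    simp only [this, capPA_empty hp.ne']
  · have : {x | |u x| < t} = Set.univ := Set.eq_univ_of_forall fun x => (hU x).trans_lt ht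
    simp [energyBelow, this]

end Main

/-- The capacitary inequality with the sharp constant `A_{p,q}` in the case `q > p`:
`( q ∫₀^∞ t^{q−1} cap_{p,a}(M_t, Ω)^{q/p} dt )^{1/q}
   ≤ A_{p,q} ( ∫_Ω |∇u|^p |x|^{−a} dx )^{1/p}`. -/
theorem capacitary_inequality
    (n : ℕ) (hn : 1 ≤ n) (Ω : Set (EuclideanSpace ℝ (Fin n))) (hΩ : IsOpen Ω)
    (p q a : ℝ) (ha : 0 ≤ a) (hp : 1 ≤ p) (hpq : p < q)
    (u : EuclideanSpace ℝ (Fin n) → ℝ) (hu : ContDiff ℝ (⊤ : ℕ∞) u)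
    (hc : HasCompactSupport u) (hsupp : tsupport u ⊆ Ω) :
    (q * ∫ t in Set.Ioi (0 : ℝ), t ^ (q - 1) *
        (capPA p a {x ∈ Ω | t ≤ |u x|} Ω) ^ (q / p)) ^ (1 / q) ≤
      (Real.Gamma (p * q / (q - p)) /
          (Real.Gamma (q / (q - p)) * Real.Gamma (p * (q - 1) / (q - p)))) ^ (1 / p - 1 / q) *
        (∫ x in Ω, ‖fderiv ℝ u x‖ ^ p * ‖x‖ ^ (-a)) ^ (1 / p) := by
  have hp0 : 0 < p := by linarith
  have hq0 : 0 < q := by linarith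
  have hqp : 0 < q - p := by linarith
  have hq1 : 0 < q - 1 := by linarith
  set E := ∫ x in Ω, ‖fderiv ℝ u x‖ ^ p * ‖x‖ ^ (-a) with hE
  have hE0 : 0 ≤ E := integral_nonneg fun x => by positivity
  have hΓ1 := Real.Gamma_pos_of_pos (show 0 < p * q / (q - p) by positivity)
  have hΓ2 := Real.Gamma_pos_of_pos (show 0 < q / (q - p) by positivity)
  have hΓ3 := Real.Gamma_pos_of_pos (show 0 < p * (q - 1) / (q - p) by positivity)
  by_cases hint : IntegrableOn (fun x => ‖fderiv ℝ u x‖ ^ p * ‖x‖ ^ (-a)) Ω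
  swap
  · rw [setIntegral_eq_zero_of_forall_eq_zero, mul_zero, Real.zero_rpow (by positivity)]
    · positivity
    intro t ht
    rw [capPA_eq_zero_of_not_integrableOn hp0 hn hΩ hu hc hsupp ?_ hint,
      Real.zero_rpow (by positivity), mul_zero]
    refine fun x hx => subset_tsupport u fun h0 => ?_
    have : t ≤ |u x| := hx.2
    rw [h0, abs_zero] at this
    exact absurd ht (not_lt.2 this)
  obtain ⟨U, hS⟩ := exists_stepBound_capPA hp0 hu hc hsupp hint
  have hLHS : 0 ≤ q * ∫ t in Set.Ioi (0 : ℝ), t ^ (q - 1) *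
      (capPA p a {x ∈ Ω | t ≤ |u x|} Ω) ^ (q / p) :=
    mul_nonneg hq0.le (setIntegral_nonneg measurableSet_Ioi fun t ht =>
      mul_nonneg (Real.rpow_nonneg (le_of_lt ht) _) (Real.rpow_nonneg (hS.nonneg t) _))
  rcases hp.eq_or_lt with rfl | hp1
  · have h := hS.integral_le_of_one hpq
    have hA : Real.Gamma (1 * q / (q - 1)) /
        (Real.Gamma (q / (q - 1)) * Real.Gamma (1 * (q - 1) / (q - 1))) = 1 := by
      rw [one_mul, one_mul, div_self hq1.ne', Real.Gamma_one, mul_one, div_self hΓ2.ne']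
    rw [hA, Real.one_rpow, one_mul]
    simp only [div_one, Real.rpow_one] at hLHS ⊢
    calc _ ≤ (E ^ q) ^ (1 / q) := Real.rpow_le_rpow hLHS h (by positivity)
      _ = E := by rw [one_div, Real.rpow_rpow_inv hE0 hq0.ne']
  · have h := hS.integral_le hp1 hpq
    have hp10 : 0 < p - 1 := by linarith
    have hα : 0 < q * (p - 1) / (q - p) := by positivity
    have hβ : 1 ≤ q / (q - p) := by rw [le_div_iff₀ hqp]; linarith
    have hB := incBeta_one_pos hα hβ
    have hA : Real.Gamma (p * q / (q - p)) /
        (Real.Gamma (q / (q - p)) * Real.Gamma (p * (q - 1) / (q - p))) =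
        (incBeta (q * (p - 1) / (q - p)) (q / (q - p)) 1)⁻¹ := by
      rw [incBeta_one hα hβ, inv_div, show q * (p - 1) / (q - p) + q / (q - p) = p * q / (q - p) by
        ring, show q * (p - 1) / (q - p) + 1 = p * (q - 1) / (q - p) by field_simp; ring]
    rw [hA, Real.inv_rpow hB.le, ← Real.rpow_neg hB.le]
    refine (Real.rpow_le_rpow hLHS h (by positivity)).trans (le_of_eq ?_)
    rw [Real.mul_rpow (by positivity) (by positivity), ← Real.rpow_mul hB.le, ← Real.rpow_mul hE0]
    congr 2 <;> field_simp
    ring
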